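/- arXiv:2312.15426 — 2 statements merged into one kernel-verified Lean document; each statement's English description precedes it below -/
import Mathlib

section
/- There is a universal constant C such that for every n ≥ 4 and every integer k ≥ 2 there is a (finitely supported) probability distribution over (deterministic) online geometric BST algorithms — a randomized online algorithm A — with the property that for every access sequence X = (x_1,…,x_m) ∈ [n]^m with m ≥ n·(log₂ n)², the expected cost satisfies E[cost_A(X)] ≤ C·(F^k(X) + m·log₂ k·log₂ log₂ n), where F^k is the k-finger bound with respect to an almost complete binary reference tree. -/
open scoped Classical

/-- A point set in the plane is arborally satisfied if every pair of points not on a common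
horizontal or vertical line has a third point of the set in the closed rectangle it spans. -/
def ArbSatZ (P : Finset (ℤ × ℤ)) : Prop :=
  ∀ p ∈ P, ∀ q ∈ P, p.1 ≠ q.1 → p.2 ≠ q.2 →
    ∃ r ∈ P, r ≠ p ∧ r ≠ q ∧ min p.1 q.1 ≤ r.1 ∧ r.1 ≤ max p.1 q.1 ∧
      min p.2 q.2 ≤ r.2 ∧ r.2 ≤ max p.2 q.2

/-- The geometric representation of an access sequence. -/
def Xp {n m : ℕ} (x : Fin m → Fin n) : Finset (ℤ × ℤ) :=
  Finset.univ.image (fun t : Fin m => (((x t : ℕ) : ℤ), ((t : ℕ) : ℤ)))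

/-- An online geometric BST algorithm over the keys `[n]`: upon receiving an access it adds a
finite set of points at the current time, depending only on the accesses seen so far. -/
structure GeomAlg (n : ℕ) where
  add : List (Fin n) → Finset (Fin n)

/-- The keys touched by the algorithm at time `t` (the accessed key, plus the added points,
which may depend only on the prefix `x_0, …, x_t` of the access sequence). -/
def GeomAlg.touched {n m : ℕ} (A : GeomAlg n) (x : Fin m → Fin n) (t : Fin m) :
    Finset (Fin n) :=
  insert (x t) (A.add ((List.ofFn x).take ((t : ℕ) + 1)))

/-- The point set produced by the algorithm on the access sequence `x`; it contains `Xp x`. -/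
noncomputable def GeomAlg.points {n m : ℕ} (A : GeomAlg n) (x : Fin m → Fin n) : Finset (ℤ × ℤ) :=
  Finset.univ.biUnion (fun t : Fin m =>
    (A.touched x t).image (fun a => (((a : ℕ) : ℤ), ((t : ℕ) : ℤ))))

/-- The cost of the algorithm on the access sequence `x`: the accessed points plus all added
points, i.e. `m` plus the number of added points. -/
def GeomAlg.cost {n m : ℕ} (A : GeomAlg n) (x : Fin m → Fin n) : ℕ :=
  ∑ t : Fin m, (A.touched x t).card

/-- A valid online geometric BST algorithm: on every access sequence of every length, the
produced point set is arborally satisfied. -/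
def GeomAlg.Valid {n : ℕ} (A : GeomAlg n) : Prop :=
  ∀ (m : ℕ) (x : Fin m → Fin n), ArbSatZ (A.points x)

/-- The number of nodes on the path between the leaves holding keys `i` and `j` in the
almost complete binary reference tree with `n` leaves holding the keys `1, …, n` in
left-to-right order (leaves indexed `0, …, n-1`). -/
def fingerDist (n : ℕ) (i j : Fin n) : ℕ :=
  if i = j then 1 else 2 * (Nat.log 2 ((i : ℕ) ^^^ (j : ℕ)) + 1) + 1

/-- The `k`-finger bound `F^k(X)` with respect to the almost complete binary reference tree:
the minimum, over all initial placements `f 0` of the `k` fingers and all movement strategies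
(at each time `t` one finger `mv t` moves to the accessed key), of the total movement cost. -/
noncomputable def Fk (n k : ℕ) {m : ℕ} (x : Fin m → Fin n) : ℕ :=
  sInf { c : ℕ | ∃ (f : ℕ → Fin k → Fin n) (mv : Fin m → Fin k),
    (∀ t : Fin m, f ((t : ℕ) + 1) = Function.update (f (t : ℕ)) (mv t) (x t)) ∧
    c = ∑ t : Fin m, fingerDist n (f (t : ℕ) (mv t)) (x t) }

namespace HierGreedy

/-- Under the greedy rule, an access to `x` touches `q` iff `q` lies in the same component as `x`
(components are the blocks of `N` consecutive keys) and `q` was touched more recently than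
every key between `x` and `q`. -/
def Touch (N : ℕ) (τ : ℕ → ℕ) (x q : ℕ) : Prop :=
  q / N = x / N ∧ ∀ r, (x ≤ r ∧ r < q) ∨ (q < r ∧ r ≤ x) → τ r < τ q

/-- `lastTouch N y t q` is one plus the last time before `t` at which greedy, serving `y`,
touches `q`, and `0` if there is none. -/
noncomputable def lastTouch (N : ℕ) (y : ℕ → ℕ) : ℕ → ℕ → ℕ
  | 0 => fun _ => 0
  | t + 1 => fun q => if Touch N (lastTouch N y t) (y t) q then t + 1 else lastTouch N y t q

/-- Greedy, serving `y` separately in each component, touches `q` at time `t`. -/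
def TouchAt (N : ℕ) (y : ℕ → ℕ) (t q : ℕ) : Prop :=
  Touch N (lastTouch N y t) (y t) q

lemma touch_self (N : ℕ) (τ : ℕ → ℕ) (x : ℕ) : Touch N τ x x :=
  ⟨rfl, fun r hr => by omega⟩

lemma lastTouch_succ (N : ℕ) (y : ℕ → ℕ) (t q : ℕ) :
    lastTouch N y (t + 1) q = if TouchAt N y t q then t + 1 else lastTouch N y t q := rfl

lemma lastTouch_le (N : ℕ) (y : ℕ → ℕ) (t q : ℕ) : lastTouch N y t q ≤ t := by
  induction t with
  | zero => simp [lastTouch]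
  | succ t ih => rw [lastTouch_succ]; split_ifs <;> omega

lemma lastTouch_congr {N : ℕ} {y z : ℕ → ℕ} {t : ℕ} (h : ∀ i < t, y i = z i) :
    lastTouch N y t = lastTouch N z t := by
  induction t with
  | zero => rfl
  | succ t ih =>
    have h1 := ih fun i hi => h i (by omega)
    funext q
    simp only [lastTouch, h1, h t (by omega)]

lemma touchAt_congr {N : ℕ} {y z : ℕ → ℕ} {t : ℕ} (h : ∀ i ≤ t, y i = z i) (q : ℕ) :
    TouchAt N y t q ↔ TouchAt N z t q := by
  unfold TouchAt
  rw [lastTouch_congr fun i hi => h i hi.le, h t le_rfl]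

lemma lastTouch_le_of_not_touchAt {N : ℕ} {y : ℕ → ℕ} {s t q : ℕ} (hst : s ≤ t)
    (h : ∀ u, s ≤ u → u < t → ¬ TouchAt N y u q) : lastTouch N y t q ≤ s := by
  induction t, hst using Nat.le_induction with
  | base => exact lastTouch_le N y s q
  | succ t hst ih =>
    rw [lastTouch_succ, if_neg (h t hst (by omega))]
    exact ih fun u h1 h2 => h u h1 (by omega)

lemma lt_lastTouch_of_touchAt {N : ℕ} {y : ℕ → ℕ} {s t q : ℕ} (hst : s < t)
    (h : TouchAt N y s q) : s < lastTouch N y t q := by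
  induction t, hst using Nat.le_induction with
  | base => rw [lastTouch_succ, if_pos h]; omega
  | succ t hst ih => rw [lastTouch_succ]; split_ifs <;> omega

lemma div_eq_of_between {N a b c : ℕ} (h : a / N = c / N) (h1 : min a c ≤ b)
    (h2 : b ≤ max a c) : b / N = a / N := by
  have e1 := Nat.div_le_div_right (c := N) h1
  have e2 := Nat.div_le_div_right (c := N) h2
  rcases le_total a c with h3 | h3
  · rw [min_eq_left h3] at e1; rw [max_eq_right h3] at e2; omega
  · rw [min_eq_right h3] at e1; rw [max_eq_left h3] at e2; omega

/-- The points touched by greedy in one component are arborally satisfied. -/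
lemma exists_touchAt_between {N : ℕ} {y : ℕ → ℕ} {s t p q : ℕ} (hst : s < t)
    (hp : TouchAt N y t p) (hq : TouchAt N y s q) (hne : p ≠ q) (hc : p / N = q / N) :
    ∃ r u, s ≤ u ∧ u ≤ t ∧ TouchAt N y u r ∧ min p q ≤ r ∧ r ≤ max p q ∧
      ¬ (r = p ∧ u = t) ∧ ¬ (r = q ∧ u = s) := by
  by_contra! hcon
  have hτq : s < lastTouch N y t q := lt_lastTouch_of_touchAt hst hq
  have hτ : ∀ r, min p q ≤ r → r ≤ max p q → r ≠ q → lastTouch N y t r ≤ s := by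
    intro r h1 h2 h3
    refine lastTouch_le_of_not_touchAt hst.le fun u h4 h5 h6 => ?_
    exact h3 (hcon r u h4 h5.le h6 h1 h2 (by omega)).1
  have hqt : ¬ TouchAt N y t q := fun h => by
    have := (hcon q t hst.le le_rfl h (by omega) (by omega) (by omega)).2
    omega
  have hτp := hτ p (by omega) (by omega) hne
  obtain ⟨hp1, hp2⟩ := hp
  have hxself : TouchAt N y t (y t) := touch_self _ _ _
  generalize hx : y t = x at *
  apply hqt
  refine ⟨by rw [hx]; omega, fun r hr => ?_⟩
  rw [hx] at hr
  by_cases h1 : min p q ≤ r ∧ r ≤ max p q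
  · have := hτ r h1.1 h1.2 (by omega)
    omega
  · by_cases h2 : (x ≤ r ∧ r < p) ∨ (p < r ∧ r ≤ x)
    · have := hp2 r h2
      by_cases h3 : (x ≤ q ∧ q < p) ∨ (p < q ∧ q ≤ x)
      · have := hp2 q h3
        omega
      · omega
    · by_cases h3 : (x ≤ q ∧ q < p) ∨ (p < q ∧ q ≤ x)
      · have := hp2 q h3
        omega
      · omega

/-- The size of a block at level `j`. -/
def blk (j : ℕ) : ℕ := 2 ^ 2 ^ j

lemma blk_pos (j : ℕ) : 0 < blk j := by unfold blk; positivity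

lemma blk_succ (j : ℕ) : blk (j + 1) = blk j * blk j := by
  unfold blk; rw [← pow_add]; congr 1; rw [pow_succ]; omega

lemma div_blk_succ (j a : ℕ) : a / blk (j + 1) = a / blk j / blk j := by
  rw [blk_succ, Nat.div_div_eq_div_mul]

lemma div_blk_eq_of_le {i j a b : ℕ} (hij : i ≤ j) (h : a / blk i = b / blk i) :
    a / blk j = b / blk j := by
  induction j, hij using Nat.le_induction with
  | base => exact h
  | succ j _ ih => rw [div_blk_succ, div_blk_succ, ih]

/-- `a` is the first or the last key of the `q`-th block of size `B`. -/
def IsEnd (B q a : ℕ) : Prop := a = q * B ∨ a + 1 = (q + 1) * B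

lemma IsEnd.div_eq {B q a : ℕ} (hB : 0 < B) (h : IsEnd B q a) : a / B = q := by
  rcases h with h | h
  · rw [h, Nat.mul_div_cancel _ hB]
  · rw [Nat.div_eq_iff hB]
    rw [add_mul] at h
    constructor <;> omega

/-- The key `a` is touched at time `t` on account of level `j` when the keys `z` are accessed. -/
def KeyTouch (z : ℕ → ℕ) (j t a : ℕ) : Prop :=
  ∃ q, TouchAt (blk j) (fun i => z i / blk j) t q ∧ IsEnd (blk j) q a

lemma touchAt_page {z : ℕ → ℕ} {i u t a : ℕ} (hiu : i ≤ u) (h : KeyTouch z i t a) :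
    TouchAt (blk u) (fun i => z i / blk u) t (a / blk u) := by
  obtain ⟨q, hq, he⟩ := h
  have hd := he.div_eq (blk_pos i)
  rcases hiu.eq_or_lt with rfl | hlt
  · rwa [hd]
  · have h1 : a / blk (i + 1) = z t / blk (i + 1) := by
      rw [div_blk_succ, div_blk_succ, hd]; exact hq.1
    rw [div_blk_eq_of_le hlt h1]
    exact touch_self _ _ _

/-- Arboral satisfaction of the keys touched at all levels, for an earlier point `(b, s)` and a
later point `(a, t)`. -/
lemma exists_keyTouch_between {z : ℕ → ℕ} {J s t a b i j : ℕ} (hst : s < t) (hab : a ≠ b)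
    (hi : i < J) (hj : j < J) (ha : KeyTouch z i t a) (hb : KeyTouch z j s b)
    (htop : z s / blk J = z t / blk J) :
    ∃ l < J, ∃ c u, s ≤ u ∧ u ≤ t ∧ KeyTouch z l u c ∧ min a b ≤ c ∧ c ≤ max a b ∧
      ¬ (c = a ∧ u = t) ∧ ¬ (c = b ∧ u = s) := by
  have hex : ∃ u, max i j ≤ u ∧ u < J ∧ z s / blk (u + 1) = z t / blk (u + 1) :=
    ⟨J - 1, by omega, by omega, by rwa [Nat.sub_add_cancel (by omega)]⟩
  obtain ⟨hu1, hu2, hu3⟩ := Nat.find_spec hex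
  have hmin := fun v => @Nat.find_min _ _ hex v
  generalize Nat.find hex = u at *
  have hpa := touchAt_page (u := u) (by omega) ha
  have hpb := touchAt_page (u := u) (by omega) hb
  have hB := blk_pos u
  by_cases hpq : a / blk u = b / blk u
  · by_cases hui : u = i
    · subst hui
      obtain ⟨q, -, he⟩ := ha
      refine ⟨u, hi, a, s, le_rfl, hst.le, ⟨q, ?_, he⟩, by omega, by omega, by omega, by omega⟩
      rwa [← he.div_eq hB, hpq]
    by_cases huj : u = j
    · subst huj
      obtain ⟨q, -, he⟩ := hb
      refine ⟨u, hj, b, t, hst.le, le_rfl, ⟨q, ?_, he⟩, by omega, by omega, by omega, by omega⟩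
      rwa [← he.div_eq hB, ← hpq]
    exfalso
    have page_eq : ∀ {l c v}, l < u → KeyTouch z l v c → c / blk u = z v / blk u := by
      rintro l c v hl ⟨q, hq, he⟩
      refine div_blk_eq_of_le (i := l + 1) hl ?_
      rw [div_blk_succ, div_blk_succ, he.div_eq (blk_pos l)]
      exact hq.1
    refine hmin (u - 1) (by omega) ⟨by omega, by omega, ?_⟩
    rw [Nat.sub_add_cancel (by omega), ← page_eq (by omega) ha, ← page_eq (by omega) hb, hpq]
  · have hca : a / blk u / blk u = b / blk u / blk u := by
      rw [hpa.1, hpb.1]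
      simp only [← div_blk_succ]
      exact hu3.symm
    have ma := Nat.div_mul_le_self a (blk u)
    have mb := Nat.div_mul_le_self b (blk u)
    have ma' : a < (a / blk u + 1) * blk u := Nat.lt_mul_of_div_lt (Nat.lt_succ_self _) hB
    have mb' : b < (b / blk u + 1) * blk u := Nat.lt_mul_of_div_lt (Nat.lt_succ_self _) hB
    set p := a / blk u with hp
    set q := b / blk u with hq
    have mono : ∀ {v w}, v < w → (v + 1) * blk u ≤ w * blk u := fun h =>
      Nat.mul_le_mul_right _ h
    have hpos : ∀ v, 0 < (v + 1) * blk u := fun v => by positivity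
    have hpp := hpos p
    have hqq := hpos q
    have hsucc : ∀ v, (v + 1) * blk u = v * blk u + blk u := fun v => by ring
    by_cases hea : IsEnd (blk u) p a
    · by_cases heb : IsEnd (blk u) q b
      · obtain ⟨r, v, h1, h2, h3, h4, h5, h6, h7⟩ := exists_touchAt_between hst hpa hpb hpq hca
        by_cases hra : r = p
        · exact ⟨u, hu2, a, v, h1, h2, ⟨r, h3, hra ▸ hea⟩, by omega, by omega, by omega, by omega⟩
        by_cases hrb : r = q
        · exact ⟨u, hu2, b, v, h1, h2, ⟨r, h3, hrb ▸ heb⟩, by omega, by omega, by omega, by omega⟩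
        have hne := hpos r
        refine ⟨u, hu2, r * blk u, v, h1, h2, ⟨r, h3, Or.inl rfl⟩, ?_⟩
        rcases lt_or_gt_of_ne hpq with h | h
        · have e1 := mono (show p < r by omega)
          have e2 := mono (show r < q by omega)
          have := hsucc r
          refine ⟨?_, ?_, ?_, ?_⟩ <;> omega
        · have e1 := mono (show q < r by omega)
          have e2 := mono (show r < p by omega)
          have := hsucc r
          refine ⟨?_, ?_, ?_, ?_⟩ <;> omega
      · unfold IsEnd at heb
        rcases lt_or_gt_of_ne hpq with h | h
        · have e1 := mono h
          exact ⟨u, hu2, q * blk u, s, le_rfl, hst.le, ⟨q, hpb, Or.inl rfl⟩,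
            by omega, by omega, by omega, by omega⟩
        · have e1 := mono h
          exact ⟨u, hu2, (q + 1) * blk u - 1, s, le_rfl, hst.le, ⟨q, hpb, Or.inr (by omega)⟩,
            by omega, by omega, by omega, by omega⟩
    · unfold IsEnd at hea
      rcases lt_or_gt_of_ne hpq with h | h
      · have e1 := mono h
        exact ⟨u, hu2, (p + 1) * blk u - 1, t, hst.le, le_rfl, ⟨p, hpa, Or.inr (by omega)⟩,
          by omega, by omega, by omega, by omega⟩
      · have e1 := mono h
        exact ⟨u, hu2, p * blk u, t, hst.le, le_rfl, ⟨p, hpa, Or.inl rfl⟩,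
          by omega, by omega, by omega, by omega⟩

/-- The hierarchical greedy algorithm with `J` levels. -/
noncomputable def alg (n J : ℕ) : GeomAlg n where
  add l := Finset.univ.filter fun a : Fin n =>
    ∃ j < J, KeyTouch (fun i => (l.map Fin.val).getD i 0) j (l.length - 1) a

/-- An access sequence, extended by zeros. -/
def ext {n m : ℕ} (x : Fin m → Fin n) (i : ℕ) : ℕ := if h : i < m then x ⟨i, h⟩ else 0

lemma ext_val {n m : ℕ} (x : Fin m → Fin n) (t : Fin m) : ext x t = x t := by
  simp [ext]

lemma mem_touched {n m J : ℕ} (hJ : 0 < J) (x : Fin m → Fin n) (t : Fin m) (a : Fin n) :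
    a ∈ (alg n J).touched x t ↔ ∃ j < J, KeyTouch (ext x) j t a := by
  have hlen : ((List.ofFn x).take ((t : ℕ) + 1)).length - 1 = t := by
    simp only [List.length_take, List.length_ofFn]; omega
  have hadd : a ∈ (alg n J).add ((List.ofFn x).take ((t : ℕ) + 1)) ↔
      ∃ j < J, KeyTouch (ext x) j t a := by
    simp only [alg, Finset.mem_filter, Finset.mem_univ, true_and, hlen]
    refine exists_congr fun j => and_congr_right fun _ => exists_congr fun q =>
      and_congr_left fun _ => touchAt_congr (fun i hi => ?_) q
    have him : i < m := by omega
    simp [ext, him, List.getD_eq_getElem?_getD, Nat.lt_succ_of_le hi]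
  rw [GeomAlg.touched, Finset.mem_insert, hadd, or_iff_right_iff_imp]
  rintro rfl
  refine ⟨0, hJ, _, touch_self _ _ _, ?_⟩
  simp only [ext_val, IsEnd, blk, pow_zero, pow_one]
  omega

lemma alg_valid {n J : ℕ} (hJ : 0 < J) (hn : n ≤ blk J) : (alg n J).Valid := by
  intro m x p hp q hq h1 h2
  have mem_points : ∀ p : ℤ × ℤ, p ∈ (alg n J).points x ↔ ∃ (t : Fin m) (a : Fin n),
      (∃ j < J, KeyTouch (ext x) j t a) ∧ (((a : ℕ) : ℤ), ((t : ℕ) : ℤ)) = p := by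
    intro p
    simp only [GeomAlg.points, Finset.mem_biUnion, Finset.mem_univ, true_and, Finset.mem_image,
      Finset.bind_def, Finset.sup_eq_biUnion, Finset.pure_def, Finset.mem_singleton]
    constructor
    · rintro ⟨t, -, ⟨a, ha, rfl⟩, rfl⟩
      exact ⟨t, a, (mem_touched hJ x t a).1 ha, rfl⟩
    · rintro ⟨t, a, ha, rfl⟩
      exact ⟨t, a, ⟨a, (mem_touched hJ x t a).2 ha, rfl⟩, rfl⟩
  wlog hlt : q.2 < p.2 generalizing p q with H
  · obtain ⟨r, hr, e1, e2, e3, e4, e5, e6⟩ := H q hq p hp h1.symm h2.symm (by omega)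
    exact ⟨r, hr, e2, e1, by omega, by omega, by omega, by omega⟩
  rw [mem_points] at hp hq
  obtain ⟨t, a, ⟨i, hi, ha⟩, rfl⟩ := hp
  obtain ⟨s, b, ⟨j, hj, hb⟩, rfl⟩ := hq
  simp only at h1 h2 hlt ⊢
  have hz : ∀ t : Fin m, ext x t / blk J = 0 := fun t => by
    rw [ext_val]; exact Nat.div_eq_of_lt (by omega)
  obtain ⟨l, hl, c, u, e1, e2, e3, e4, e5, e6, e7⟩ :=
    exists_keyTouch_between (by omega) (by omega) hi hj ha hb (by rw [hz, hz])
  refine ⟨((c : ℕ), (u : ℕ)), ?_, ?_, ?_, ?_, ?_, ?_, ?_⟩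
  · rw [mem_points]
    exact ⟨⟨u, by omega⟩, ⟨c, by omega⟩, ⟨l, hl, e3⟩, rfl⟩
  · intro h; rw [Prod.mk.injEq] at h; omega
  · intro h; rw [Prod.mk.injEq] at h; omega
  all_goals (simp only; omega)

/-- The keys `r` an access to which would touch `q`. -/
noncomputable def nbhd (n N : ℕ) (τ : ℕ → ℕ) (q : ℕ) : Finset ℕ :=
  (Finset.range n).filter fun r => Touch N τ r q

/-- The total weight of the neighbourhood of `q`. -/
noncomputable def mass (n N : ℕ) (τ : ℕ → ℕ) (w : ℕ → ℝ) (q : ℕ) : ℝ :=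
  ∑ r ∈ nbhd n N τ q, w r

/-- The potential function in the analysis of greedy. -/
noncomputable def pot (n N : ℕ) (τ : ℕ → ℕ) (w : ℕ → ℝ) : ℝ :=
  ∑ q ∈ Finset.range n, Real.logb 2 (mass n N τ w q)

/-- A telescoping estimate along a chain of touched keys. -/
lemma chain_sum_aux {R : ℕ → ℕ → Prop} {Q : ℕ → Prop} {s go gn : ℕ → ℝ} {W : ℝ}
    (hs : ∀ q, Q q → 0 < s q ∧ s q ≤ W ∧ s q ≤ go q ∧ 0 < gn q ∧ gn q ≤ W)
    (hgn : ∀ p q r, Q p → Q q → Q r → R p q → R q r → gn q ≤ s r - s p) :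
    ∀ (l : List ℕ) (a b : ℕ), (a :: b :: l).Pairwise R → (∀ q ∈ a :: b :: l, Q q) →
      ((b :: l).map fun q => 1 + Real.logb 2 (gn q)).sum
        - (l.map fun q => Real.logb 2 (go q)).sum
        ≤ 1 + 3 * Real.logb 2 W - Real.logb 2 (s a) - Real.logb 2 (s b) := by
  intro l
  induction l with
  | nil =>
    intro a b _ hQ
    obtain ⟨a1, a2, -, -, -⟩ := hs a (hQ a (by simp))
    obtain ⟨b1, b2, -, b4, b5⟩ := hs b (hQ b (by simp))
    have h1 := Real.logb_le_logb_of_le one_lt_two a1 a2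
    have h2 := Real.logb_le_logb_of_le one_lt_two b1 b2
    have h3 := Real.logb_le_logb_of_le one_lt_two b4 b5
    simp only [List.map_cons, List.map_nil, List.sum_cons, List.sum_nil]
    linarith
  | cons c l ih =>
    intro a b hp hQ
    have ih' := ih b c (List.pairwise_cons.1 hp).2 fun q hq => hQ q (List.mem_cons_of_mem _ hq)
    have Qa := hQ a (by simp)
    have Qb := hQ b (by simp)
    have Qc := hQ c (by simp)
    have Rab : R a b := (List.pairwise_cons.1 hp).1 b (by simp)
    have Rbc : R b c := (List.pairwise_cons.1 (List.pairwise_cons.1 hp).2).1 c (by simp)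
    obtain ⟨a1, -, -, -, -⟩ := hs a Qa
    obtain ⟨b1, -, -, b4, -⟩ := hs b Qb
    obtain ⟨c1, -, c3, -, -⟩ := hs c Qc
    have hg := hgn a b c Qa Qb Qc Rab Rbc
    have key : 1 + Real.logb 2 (gn b) + Real.logb 2 (s a)
        ≤ Real.logb 2 (s c) + Real.logb 2 (s c) := by
      rw [← Real.logb_mul c1.ne' c1.ne']
      have h2 : (1 : ℝ) = Real.logb 2 2 := by norm_num
      conv_lhs => rw [h2]
      rw [← Real.logb_mul two_ne_zero b4.ne', ← Real.logb_mul (by positivity) a1.ne']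
      refine Real.logb_le_logb_of_le one_lt_two (by positivity) ?_
      nlinarith [sq_nonneg (s c - s a), sq_nonneg (s c - 2 * s a),
        mul_le_mul_of_nonneg_right hg a1.le]
    have hc := Real.logb_le_logb_of_le one_lt_two c1 c3
    simp only [List.map_cons, List.sum_cons] at ih' ⊢
    linarith

lemma chain_sum {R : ℕ → ℕ → Prop} {Q : ℕ → Prop} {s go gn : ℕ → ℝ} {W : ℝ}
    (hs : ∀ q, Q q → 0 < s q ∧ s q ≤ W ∧ s q ≤ go q ∧ 0 < gn q ∧ gn q ≤ W)
    (hgn : ∀ p q r, Q p → Q q → Q r → R p q → R q r → gn q ≤ s r - s p)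
    (hmono : ∀ p q, R p q → s p ≤ s q) {l : List ℕ} {x : ℕ}
    (hl : (x :: l).Pairwise R) (hQ : ∀ q ∈ x :: l, Q q) :
    (l.map fun q => 1 + Real.logb 2 (gn q) - Real.logb 2 (go q)).sum
      ≤ 1 + 3 * (Real.logb 2 W - Real.logb 2 (s x)) := by
  obtain ⟨x1, x2, -, -, -⟩ := hs x (hQ x (by simp))
  have hx := Real.logb_le_logb_of_le one_lt_two x1 x2
  cases l with
  | nil => simp only [List.map_nil, List.sum_nil]; linarith
  | cons b l =>
    have h := chain_sum_aux hs hgn l x b hl hQ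
    obtain ⟨b1, -, b3, -, -⟩ := hs b (hQ b (by simp))
    have hb := Real.logb_le_logb_of_le one_lt_two b1 b3
    have hxb := Real.logb_le_logb_of_le one_lt_two x1
      (hmono x b ((List.pairwise_cons.1 hl).1 b (by simp)))
    have e : ∀ l : List ℕ, (l.map fun q => 1 + Real.logb 2 (gn q) - Real.logb 2 (go q)).sum
        = (l.map fun q => 1 + Real.logb 2 (gn q)).sum
          - (l.map fun q => Real.logb 2 (go q)).sum := fun l => by
      induction l with
      | nil => simp
      | cons c l ih => simp only [List.map_cons, List.sum_cons, ih]; ring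
    rw [e, List.map_cons (l := l) (f := fun q => Real.logb 2 (go q)), List.sum_cons]
    linarith

section Access

variable {n N T x : ℕ} {τ τ' : ℕ → ℕ} {w w' : ℕ → ℝ} {W : ℝ}

lemma mass_pos (hw : ∀ r, 0 < w r) {q : ℕ} (hq : q < n) : 0 < mass n N τ w q :=
  Finset.sum_pos (fun r _ => hw r)
    ⟨q, Finset.mem_filter.2 ⟨Finset.mem_range.2 hq, touch_self _ _ _⟩⟩

lemma le_mass (hw : ∀ r, 0 < w r) {q : ℕ} (hq : q < n) : w q ≤ mass n N τ w q :=
  Finset.single_le_sum (fun r _ => (hw r).le)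
    (Finset.mem_filter.2 ⟨Finset.mem_range.2 hq, touch_self _ _ _⟩)

lemma mass_le (hw : ∀ r, 0 < w r)
    (hW : ∀ c, ∑ r ∈ (Finset.range n).filter (fun r => r / N = c), w r ≤ W) (q : ℕ) :
    mass n N τ w q ≤ W := by
  refine (Finset.sum_le_sum_of_subset_of_nonneg (fun r hr => ?_) fun r _ _ => (hw r).le).trans
    (hW (q / N))
  obtain ⟨h1, h2⟩ := Finset.mem_filter.1 hr
  exact Finset.mem_filter.2 ⟨h1, h2.1.symm⟩

/-- The total weight of the keys between `x` and `q`, inclusive. -/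
noncomputable def span (n : ℕ) (w : ℕ → ℝ) (x q : ℕ) : ℝ :=
  ∑ r ∈ (Finset.range n).filter (fun r => min x q ≤ r ∧ r ≤ max x q), w r

lemma le_span (hw : ∀ r, 0 < w r) {q : ℕ} (hx : x < n) : w x ≤ span n w x q :=
  Finset.single_le_sum (fun r _ => (hw r).le)
    (Finset.mem_filter.2 ⟨Finset.mem_range.2 hx, by omega, by omega⟩)

lemma span_le_mass (hw : ∀ r, 0 < w r) {q : ℕ} (h : Touch N τ x q) :
    span n w x q ≤ mass n N τ w q := by
  refine Finset.sum_le_sum_of_subset_of_nonneg (fun r hr => ?_) fun r _ _ => (hw r).le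
  obtain ⟨h1, h2, h3⟩ := Finset.mem_filter.1 hr
  refine Finset.mem_filter.2 ⟨h1, ?_, fun y hy => h.2 y (by omega)⟩
  have := div_eq_of_between h.1.symm h2 h3
  rw [this, h.1]

lemma chain_touched (R : ℕ → ℕ → Prop) (hR : R = (· < ·) ∨ R = (· > ·)) (hx : x < n)
    (hτ' : ∀ q, τ' q = if Touch N τ x q then T else τ q)
    (hw : ∀ r, 0 < w r) (hw' : ∀ r, 0 < w' r) (hww : ∀ r ≠ x, w' r ≤ w r)
    (hW : ∀ c, ∑ r ∈ (Finset.range n).filter (fun r => r / N = c), w r ≤ W)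
    (hW' : ∀ c, ∑ r ∈ (Finset.range n).filter (fun r => r / N = c), w' r ≤ W)
    {l : List ℕ} (hl : (x :: l).Pairwise R) (hQ : ∀ q ∈ l, q < n ∧ Touch N τ x q) :
    (l.map fun q => 1 + Real.logb 2 (mass n N τ' w' q) - Real.logb 2 (mass n N τ w q)).sum
      ≤ 1 + 3 * (Real.logb 2 W - Real.logb 2 (w x)) := by
  have hspan : span n w x x = w x := by
    have : (Finset.range n).filter (fun r => min x x ≤ r ∧ r ≤ max x x) = {x} := by
      ext r
      simp only [Finset.mem_filter, Finset.mem_range, Finset.mem_singleton]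
      omega
    rw [span, this, Finset.sum_singleton]
  rw [← hspan]
  refine chain_sum (R := fun p q => R p q ∧ (p = x ∨ R x p))
    (Q := fun q => q < n ∧ Touch N τ x q) (s := span n w x) ?_ ?_ ?_ ?_ ?_
  · rintro q ⟨hq, ht⟩
    have h1 := (hw x).trans_le (le_span hw (q := q) hx)
    have h2 := span_le_mass (n := n) hw ht
    exact ⟨h1, h2.trans (mass_le hw hW q), h2, mass_pos hw' hq, mass_le hw' hW' q⟩
  · rintro p q r ⟨-, hp⟩ ⟨-, hq⟩ ⟨hr, hr'⟩ ⟨h1, h2⟩ ⟨h3, -⟩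
    have hqx : q ≠ x := by
      rcases hR with rfl | rfl <;> simp only at * <;> omega
    have hTp : τ' p = T := by rw [hτ', if_pos hp]
    have hTq : τ' q = T := by rw [hτ', if_pos hq]
    have hTr : τ' r = T := by rw [hτ', if_pos hr']
    have hsub : ∀ y ∈ nbhd n N τ' q, y < n ∧ ((p < y ∧ y < r) ∨ (r < y ∧ y < p)) := by
      intro y hy
      obtain ⟨hy1, -, hy2⟩ := Finset.mem_filter.1 hy
      refine ⟨Finset.mem_range.1 hy1, ?_⟩
      have e1 : ¬ ((y ≤ p ∧ p < q) ∨ (q < p ∧ p ≤ y)) := fun h => by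
        have := hy2 p h
        omega
      have e2 : ¬ ((y ≤ r ∧ r < q) ∨ (q < r ∧ r ≤ y)) := fun h => by
        have := hy2 r h
        omega
      rcases hR with rfl | rfl <;> simp only at * <;> omega
    have hge : mass n N τ' w' q ≤ mass n N τ' w q := by
      refine Finset.sum_le_sum fun y hy => hww y ?_
      have := hsub y hy
      rcases hR with rfl | rfl <;> simp only at * <;> omega
    have hadd : mass n N τ' w q + span n w x p ≤ span n w x r := by
      rw [mass, span, ← Finset.sum_union]
      · refine Finset.sum_le_sum_of_subset_of_nonneg (fun y hy => ?_) fun y _ _ => (hw y).le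
        rw [Finset.mem_union, Finset.mem_filter, Finset.mem_range] at hy
        rw [Finset.mem_filter, Finset.mem_range]
        rcases hy with hy | hy
        · have := hsub y hy
          rcases hR with rfl | rfl <;> simp only at * <;> omega
        · rcases hR with rfl | rfl <;> simp only at * <;> omega
      · rw [Finset.disjoint_left]
        intro y hy hy'
        have := hsub y hy
        rw [Finset.mem_filter] at hy'
        rcases hR with rfl | rfl <;> simp only at * <;> omega
    linarith
  · rintro p q ⟨h1, h2⟩
    refine Finset.sum_le_sum_of_subset_of_nonneg (fun y hy => ?_) fun y _ _ => (hw y).le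
    rw [Finset.mem_filter, Finset.mem_range] at hy ⊢
    rcases hR with rfl | rfl <;> simp only at * <;> omega
  · rw [List.pairwise_cons] at hl ⊢
    exact ⟨fun q hq => ⟨hl.1 q hq, Or.inl rfl⟩,
      hl.2.imp_of_mem fun {a b} ha _ h => ⟨h, Or.inr (hl.1 a ha)⟩⟩
  · intro q hq
    rcases List.mem_cons.1 hq with rfl | hq
    · exact ⟨hx, touch_self _ _ _⟩
    · exact hQ q hq

/-- The access lemma for greedy with changing weights: the amortized cost of an access to `x` is
logarithmic in `W / w x`. -/
lemma access_lemma (hx : x < n)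
    (hτ : ∀ q, τ q < T) (hτ' : ∀ q, τ' q = if Touch N τ x q then T else τ q)
    (hw : ∀ r, 0 < w r) (hw' : ∀ r, 0 < w' r) (hww : ∀ r ≠ x, w' r ≤ w r)
    (hW : ∀ c, ∑ r ∈ (Finset.range n).filter (fun r => r / N = c), w r ≤ W)
    (hW' : ∀ c, ∑ r ∈ (Finset.range n).filter (fun r => r / N = c), w' r ≤ W) :
    (((Finset.range n).filter fun q => Touch N τ x q).card : ℝ) + pot n N τ' w' - pot n N τ w
      ≤ 3 + 7 * (Real.logb 2 W - Real.logb 2 (w x)) := by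
  set D : ℕ → ℝ := fun q =>
    1 + Real.logb 2 (mass n N τ' w' q) - Real.logb 2 (mass n N τ w q) with hD
  have hside : ∀ R : ℕ → ℕ → Prop, (R = (· < ·) ∨ R = (· > ·)) → ∀ l : List ℕ,
      l.Pairwise R → l.Nodup → (∀ q, q ∈ l ↔ q < n ∧ Touch N τ x q ∧ R x q) →
      ∑ q ∈ (Finset.range n).filter (fun q => Touch N τ x q ∧ R x q), D q
        ≤ 1 + 3 * (Real.logb 2 W - Real.logb 2 (w x)) := by
    intro R hR l hl hnd hmem
    have : (Finset.range n).filter (fun q => Touch N τ x q ∧ R x q) = l.toFinset := by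
      ext q; simp [hmem]
    rw [this, List.sum_toFinset D hnd]
    exact chain_touched R hR hx hτ' hw hw' hww hW hW'
      (List.pairwise_cons.2 ⟨fun q hq => ((hmem q).1 hq).2.2, hl⟩)
      fun q hq => ⟨((hmem q).1 hq).1, ((hmem q).1 hq).2.1⟩
  have hright : ∑ q ∈ (Finset.range n).filter (fun q => Touch N τ x q ∧ x < q), D q
      ≤ 1 + 3 * (Real.logb 2 W - Real.logb 2 (w x)) := by
    convert hside (· < ·) (Or.inl rfl)
      (((Finset.range n).filter (fun q => Touch N τ x q ∧ x < q)).sort (· ≤ ·))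
      (Finset.sortedLT_sort _).pairwise (Finset.sort_nodup _ _) (by simp)
  have hleft : ∑ q ∈ (Finset.range n).filter (fun q => Touch N τ x q ∧ x > q), D q
      ≤ 1 + 3 * (Real.logb 2 W - Real.logb 2 (w x)) := by
    convert hside (· > ·) (Or.inr rfl)
      (((Finset.range n).filter (fun q => Touch N τ x q ∧ x > q)).sort (· ≥ ·))
      (Finset.sortedGT_sort _).pairwise (Finset.sort_nodup _ _) (by simp)
  have hDx : D x ≤ 1 + (Real.logb 2 W - Real.logb 2 (w x)) := by
    have h1 := Real.logb_le_logb_of_le one_lt_two (mass_pos (N := N) (τ := τ') hw' hx)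
      (mass_le hw' hW' x)
    have h2 := Real.logb_le_logb_of_le one_lt_two (hw x) (le_mass (N := N) (τ := τ) hw hx)
    simp only [hD]
    linarith
  have hpt : ∀ q ∈ Finset.range n, (if Touch N τ x q then (1 : ℝ) else 0)
      + Real.logb 2 (mass n N τ' w' q) - Real.logb 2 (mass n N τ w q)
      ≤ (if q = x then D q else 0) + (if Touch N τ x q ∧ x < q then D q else 0)
        + (if Touch N τ x q ∧ x > q then D q else 0) := by
    intro q hq
    by_cases ht : Touch N τ x q
    · rcases lt_trichotomy q x with h | h | h
      · simp [ht, h, h.ne, hD, not_lt.2 h.le]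
      · subst h; simp [ht, hD]
      · simp [ht, h, h.ne', hD, not_lt.2 h.le]
    · have hqx : q ≠ x := fun h => ht (h ▸ touch_self _ _ _)
      have hTq : τ' q = τ q := by rw [hτ', if_neg ht]
      have hsub : ∀ y ∈ nbhd n N τ' q, y ∈ nbhd n N τ q := by
        intro y hy
        obtain ⟨h1, h2, h3⟩ := Finset.mem_filter.1 hy
        refine Finset.mem_filter.2 ⟨h1, h2, fun r hr => ?_⟩
        have h4 := h3 r hr
        rw [hTq, hτ'] at h4
        split_ifs at h4 with h5
        · have := hτ q; omega
        · exact h4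
      have hxn : x ∉ nbhd n N τ q := fun h => ht (Finset.mem_filter.1 h).2
      have h1 : mass n N τ' w' q ≤ mass n N τ w q :=
        (Finset.sum_le_sum fun y hy => hww y fun h => hxn (h ▸ hsub y hy)).trans
          (Finset.sum_le_sum_of_subset_of_nonneg hsub fun y _ _ => (hw y).le)
      have h2 := Real.logb_le_logb_of_le one_lt_two
        (mass_pos (N := N) (τ := τ') hw' (Finset.mem_range.1 hq)) h1
      simp only [ht, hqx, if_false, false_and]
      linarith
  have hsum := Finset.sum_le_sum hpt
  simp only [Finset.sum_add_distrib, Finset.sum_sub_distrib, ← Finset.sum_filter] at hsum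
  rw [Finset.sum_filter (fun q => q = x), Finset.sum_ite_eq' _ x D,
    if_pos (Finset.mem_range.2 hx), Finset.sum_const, nsmul_eq_mul, mul_one] at hsum
  simp only [pot]
  linarith

end Access

/-- The weight of the page `q` of size `B`, for the configuration `f` of `k` fingers: pages holding
a finger are heavy. -/
noncomputable def pageWeight {n k : ℕ} (B : ℕ) (f : Fin k → Fin n) (q : ℕ) : ℝ :=
  1 + if ∃ i, (f i : ℕ) / B = q then (B : ℝ) / k else 0

lemma one_le_pageWeight {n k : ℕ} (B : ℕ) (f : Fin k → Fin n) (q : ℕ) : 1 ≤ pageWeight B f q := by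
  unfold pageWeight; split_ifs
  · have : (0 : ℝ) ≤ (B : ℝ) / k := by positivity
    linarith
  · simp

lemma sum_pageWeight_le {n k B : ℕ} (hk : 0 < k) (hB : 0 < B) (f : Fin k → Fin n) (c : ℕ) :
    ∑ r ∈ (Finset.range n).filter (fun r => r / B = c), pageWeight B f r ≤ 2 * B := by
  have h1 : ((Finset.range n).filter (fun r => r / B = c)).card ≤ B := by
    calc _ ≤ (Finset.Ico (c * B) (c * B + B)).card := by
          refine Finset.card_le_card fun r hr => ?_
          have := (Nat.div_eq_iff hB).1 (Finset.mem_filter.1 hr).2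
          rw [Finset.mem_Ico]
          omega
      _ = B := by simp
  have h2 : (((Finset.range n).filter (fun r => r / B = c)).filter
      (fun q => ∃ i, (f i : ℕ) / B = q)).card ≤ k := by
    calc _ ≤ (Finset.univ.image fun i => (f i : ℕ) / B).card := by
          refine Finset.card_le_card fun r hr => ?_
          obtain ⟨i, hi⟩ := (Finset.mem_filter.1 hr).2
          exact Finset.mem_image.2 ⟨i, Finset.mem_univ _, hi⟩
      _ ≤ k := Finset.card_image_le.trans (by simp)
  simp only [pageWeight, Finset.sum_add_distrib, ← Finset.sum_filter, Finset.sum_const,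
    nsmul_eq_mul, mul_one]
  have h3 : (B : ℝ) = k * ((B : ℝ) / k) := by field_simp
  have h1' : (((Finset.range n).filter (fun r => r / B = c)).card : ℝ) ≤ B := by exact_mod_cast h1
  have h2' := mul_le_mul_of_nonneg_right
    (Nat.cast_le (α := ℝ).2 h2) (show (0 : ℝ) ≤ (B : ℝ) / k by positivity)
  linarith

lemma lt_of_div_ne {a b j : ℕ} (h : a / blk j ≠ b / blk j) : 2 ^ j ≤ Nat.log 2 (a ^^^ b) := by
  by_contra! hlt
  apply h
  have h1 : a ^^^ b < 2 ^ 2 ^ j := Nat.lt_pow_of_log_lt one_lt_two hlt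
  have h2 : (a ^^^ b) >>> 2 ^ j = 0 := by
    rw [Nat.shiftRight_eq_div_pow]; exact Nat.div_eq_of_lt h1
  rw [Nat.shiftRight_xor_distrib, Nat.xor_eq_zero_iff, Nat.shiftRight_eq_div_pow,
    Nat.shiftRight_eq_div_pow] at h2
  exact h2

lemma le_fingerDist {n j : ℕ} {a b : Fin n} (h : (a : ℕ) / blk j ≠ (b : ℕ) / blk j) :
    2 ^ j ≤ fingerDist n a b := by
  have hne : a ≠ b := fun e => h (by rw [e])
  have := lt_of_div_ne h
  rw [fingerDist, if_neg hne]
  omega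

lemma sum_two_pow_le (J d : ℕ) :
    ∑ j ∈ Finset.range J, (if 2 ^ j ≤ d then 2 ^ j else 0) ≤ 2 * d := by
  rcases Nat.eq_zero_or_pos d with rfl | hd
  · simp
  rw [← Finset.sum_filter]
  calc _ ≤ ∑ j ∈ Finset.range (Nat.log 2 d + 1), 2 ^ j := by
        refine Finset.sum_le_sum_of_subset fun j hj => ?_
        rw [Finset.mem_range]
        have := Nat.le_log_of_pow_le one_lt_two (Finset.mem_filter.1 hj).2
        omega
    _ = 2 ^ (Nat.log 2 d + 1) - 1 := by rw [Nat.geomSum_eq le_rfl]; simp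
    _ ≤ 2 * d := by
        have := Nat.pow_log_le_self 2 hd.ne'
        rw [pow_succ]; omega

section Level

variable {n k m : ℕ} {x : Fin m → Fin n} {f : ℕ → Fin k → Fin n} {mv : Fin m → Fin k}

/-- The number of pages touched at time `t` on level `j`. -/
noncomputable def pageCount (n : ℕ) (z : ℕ → ℕ) (j t : ℕ) : ℕ :=
  ((Finset.range n).filter fun q => TouchAt (blk j) (fun i => z i / blk j) t q).card

lemma logb_pageWeight (hk : 0 < k) (j : ℕ) (a b : Fin n) (g : Fin k → Fin n) (i : Fin k)
    (hg : g i = a) :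
    Real.logb 2 (2 * blk j) - Real.logb 2 (pageWeight (blk j) g ((b : ℕ) / blk j))
      ≤ 1 + Real.logb 2 k
        + ((if 2 ^ j ≤ fingerDist n a b then 2 ^ j else 0 : ℕ) : ℝ) := by
  have hB : (0 : ℝ) < blk j := by exact_mod_cast blk_pos j
  have hk' : (1 : ℝ) ≤ k := by exact_mod_cast hk
  have hlk : 0 ≤ Real.logb 2 k := Real.logb_nonneg one_lt_two hk'
  have hlB : Real.logb 2 (blk j) = 2 ^ j := by
    have : ((blk j : ℕ) : ℝ) = (2 : ℝ) ^ (2 ^ j : ℕ) := by simp [blk]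
    rw [this, Real.logb_pow]; simp
  rw [Real.logb_mul two_ne_zero hB.ne']
  have h2 : Real.logb 2 2 = 1 := by norm_num
  rw [h2]
  by_cases hm : ∃ i, (g i : ℕ) / blk j = (b : ℕ) / blk j
  · have h1 : Real.logb 2 (blk j / k)
        ≤ Real.logb 2 (pageWeight (blk j) g ((b : ℕ) / blk j)) := by
      refine Real.logb_le_logb_of_le one_lt_two (by positivity) ?_
      rw [pageWeight, if_pos hm]; linarith
    rw [Real.logb_div hB.ne' (by positivity)] at h1
    have := Nat.cast_nonneg (α := ℝ) (if 2 ^ j ≤ fingerDist n a b then 2 ^ j else 0)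
    linarith
  · have h1 : 0 ≤ Real.logb 2 (pageWeight (blk j) g ((b : ℕ) / blk j)) :=
      Real.logb_nonneg one_lt_two (one_le_pageWeight _ _ _)
    have h3 : 2 ^ j ≤ fingerDist n a b := le_fingerDist fun h => hm ⟨i, hg ▸ h⟩
    rw [if_pos h3, hlB]
    push_cast
    linarith

/-- The amortized cost of one access on level `j`. -/
lemma level_step (hk : 0 < k) (j : ℕ)
    (hf : ∀ t : Fin m, f ((t : ℕ) + 1) = Function.update (f t) (mv t) (x t)) (t : Fin m) :
    (pageCount n (ext x) j t : ℝ)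
      + pot n (blk j) (lastTouch (blk j) (fun i => ext x i / blk j) (t + 1))
          (pageWeight (blk j) (f (t + 1)))
      - pot n (blk j) (lastTouch (blk j) (fun i => ext x i / blk j) t) (pageWeight (blk j) (f t))
      ≤ 10 + 7 * Real.logb 2 k
        + 7 * ((if 2 ^ j ≤ fingerDist n (f t (mv t)) (x t) then 2 ^ j else 0 : ℕ) : ℝ) := by
  have hpos : ∀ g : Fin k → Fin n, ∀ r, 0 < pageWeight (blk j) g r := fun g r =>
    one_pos.trans_le (one_le_pageWeight _ _ _)
  have h := access_lemma (n := n) (N := blk j) (T := t + 1) (x := (x t : ℕ) / blk j)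
    (τ := lastTouch (blk j) (fun i => ext x i / blk j) t)
    (τ' := lastTouch (blk j) (fun i => ext x i / blk j) (t + 1))
    (w := pageWeight (blk j) (f t)) (w' := pageWeight (blk j) (f (t + 1)))
    ((Nat.div_le_self _ _).trans_lt (x t).2)
    (fun q => Nat.lt_succ_of_le (lastTouch_le _ _ _ _))
    (fun q => by rw [lastTouch_succ, TouchAt, ext_val]) (hpos _) (hpos _) ?_
    (sum_pageWeight_le hk (blk_pos j) _) (sum_pageWeight_le hk (blk_pos j) _)
  · have h2 := logb_pageWeight hk j (f t (mv t)) (x t) (f t) (mv t) rfl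
    have h3 : ((Finset.range n).filter fun q => Touch (blk j)
        (lastTouch (blk j) (fun i => ext x i / blk j) t) ((x t : ℕ) / blk j) q).card
        = pageCount n (ext x) j t := by
      simp only [pageCount, TouchAt, ext_val]
    rw [h3] at h
    linarith
  · intro r hr
    have himp : (∃ i, (f (t + 1) i : ℕ) / blk j = r) → ∃ i, (f t i : ℕ) / blk j = r := by
      rintro ⟨i, hi⟩
      rw [hf t] at hi
      by_cases him : i = mv t
      · subst him
        rw [Function.update_self] at hi
        exact absurd hi.symm hr
      · rw [Function.update_of_ne him] at hi
        exact ⟨i, hi⟩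
    have : (0 : ℝ) ≤ (blk j : ℝ) / k := by positivity
    simp only [pageWeight]
    split_ifs with h1 h2
    · exact le_rfl
    · exact absurd (himp h1) h2
    · linarith
    · exact le_rfl

lemma level_sum (hk : 0 < k) (j : ℕ)
    (hf : ∀ t : Fin m, f ((t : ℕ) + 1) = Function.update (f t) (mv t) (x t)) :
    ∑ t : Fin m, (pageCount n (ext x) j t : ℝ) ≤ n * (1 + 2 ^ j)
      + m * (10 + 7 * Real.logb 2 k)
      + 7 * ∑ t : Fin m,
        ((if 2 ^ j ≤ fingerDist n (f t (mv t)) (x t) then 2 ^ j else 0 : ℕ) : ℝ) := by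
  set Φ : ℕ → ℝ := fun t => pot n (blk j) (lastTouch (blk j) (fun i => ext x i / blk j) t)
    (pageWeight (blk j) (f t)) with hΦ
  have hpos : ∀ g : Fin k → Fin n, ∀ r, 0 < pageWeight (blk j) g r := fun g r =>
    one_pos.trans_le (one_le_pageWeight _ _ _)
  have htel : ∑ t : Fin m, (Φ (t + 1) - Φ t) = Φ m - Φ 0 := by
    rw [Fin.sum_univ_eq_sum_range (fun t => Φ (t + 1) - Φ t), Finset.sum_range_sub]
  have hend : 0 ≤ Φ m := Finset.sum_nonneg fun q hq => Real.logb_nonneg one_lt_two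
    ((one_le_pageWeight _ _ _).trans (le_mass (hpos _) (Finset.mem_range.1 hq)))
  have hstart : Φ 0 ≤ n * (1 + 2 ^ j) := by
    have hlB : Real.logb 2 (2 * blk j) = 1 + 2 ^ j := by
      have : (2 * (blk j : ℕ) : ℝ) = (2 : ℝ) ^ (1 + 2 ^ j : ℕ) := by simp [blk, pow_add]
      rw [this, Real.logb_pow]; simp
    calc Φ 0 ≤ ∑ _q ∈ Finset.range n, Real.logb 2 (2 * blk j) := by
          refine Finset.sum_le_sum fun q hq => Real.logb_le_logb_of_le one_lt_two
            (mass_pos (hpos _) (Finset.mem_range.1 hq))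
            (mass_le (hpos _) (sum_pageWeight_le hk (blk_pos j) _) q)
      _ = _ := by rw [hlB, Finset.sum_const, Finset.card_range, nsmul_eq_mul]
  have hsum := Finset.sum_le_sum fun t (_ : t ∈ Finset.univ) => level_step hk j hf t
  have hL : ∑ t : Fin m, (pageCount n (ext x) j t : ℝ) + (Φ m - Φ 0) ≤ m * (10 + 7 * Real.logb 2 k)
      + 7 * ∑ t : Fin m,
        ((if 2 ^ j ≤ fingerDist n (f t (mv t)) (x t) then 2 ^ j else 0 : ℕ) : ℝ) := by
    rw [← htel, ← Finset.sum_add_distrib, Finset.mul_sum]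
    refine (Finset.sum_le_sum fun t _ => ?_).trans (hsum.trans_eq ?_)
    · simp only [hΦ]; linarith
    · rw [Finset.sum_add_distrib, Finset.sum_const, Finset.card_univ, Fintype.card_fin,
        nsmul_eq_mul]
  linarith

end Level

/-- At each level and time, at most two keys are touched per touched page. -/
lemma card_touched_le {n m J : ℕ} (hJ : 0 < J) (x : Fin m → Fin n) (t : Fin m) :
    ((alg n J).touched x t).card ≤ ∑ j ∈ Finset.range J, 2 * pageCount n (ext x) j t := by
  set P : ℕ → Finset ℕ := fun j =>
    (Finset.range n).filter fun q => TouchAt (blk j) (fun i => ext x i / blk j) t q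
  calc ((alg n J).touched x t).card
      = (((alg n J).touched x t).image Fin.val).card :=
        (Finset.card_image_of_injective _ Fin.val_injective).symm
    _ ≤ ((Finset.range J).biUnion fun j => (P j).image (fun q => q * blk j) ∪
          (P j).image (fun q => (q + 1) * blk j - 1)).card := by
        refine Finset.card_le_card fun b hb => ?_
        obtain ⟨a, ha, rfl⟩ := Finset.mem_image.1 hb
        obtain ⟨j, hj, q, hq, he⟩ := (mem_touched hJ x t a).1 ha
        have hqn : q ∈ P j := by
          refine Finset.mem_filter.2 ⟨Finset.mem_range.2 ?_, hq⟩
          rw [← he.div_eq (blk_pos j)]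
          exact (Nat.div_le_self _ _).trans_lt a.2
        refine Finset.mem_biUnion.2 ⟨j, Finset.mem_range.2 hj, Finset.mem_union.2 ?_⟩
        rcases he with he | he
        · exact Or.inl (Finset.mem_image.2 ⟨q, hqn, he.symm⟩)
        · exact Or.inr (Finset.mem_image.2 ⟨q, hqn, by omega⟩)
    _ ≤ ∑ j ∈ Finset.range J, 2 * pageCount n (ext x) j t := by
        refine Finset.card_biUnion_le.trans (Finset.sum_le_sum fun j _ => ?_)
        refine (Finset.card_union_le _ _).trans ?_
        have h1 := Finset.card_image_le (s := P j) (f := fun q => q * blk j)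
        have h2 := Finset.card_image_le (s := P j) (f := fun q => (q + 1) * blk j - 1)
        have h3 : pageCount n (ext x) j t = (P j).card := rfl
        omega

lemma exists_fingers {n k m : ℕ} (hn : 0 < n) (hk : 0 < k) (x : Fin m → Fin n) :
    ∃ (f : ℕ → Fin k → Fin n) (mv : Fin m → Fin k),
      (∀ t : Fin m, f ((t : ℕ) + 1) = Function.update (f (t : ℕ)) (mv t) (x t)) ∧
      Fk n k x = ∑ t : Fin m, fingerDist n (f (t : ℕ) (mv t)) (x t) := by
  refine Nat.sInf_mem (s := {c : ℕ | ∃ (f : ℕ → Fin k → Fin n) (mv : Fin m → Fin k),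
    (∀ t : Fin m, f ((t : ℕ) + 1) = Function.update (f (t : ℕ)) (mv t) (x t)) ∧
    c = ∑ t : Fin m, fingerDist n (f (t : ℕ) (mv t)) (x t)}) ⟨_, fun t => Nat.rec (fun _ => ⟨0, hn⟩)
    (fun t g => if h : t < m then Function.update g ⟨0, hk⟩ (x ⟨t, h⟩) else g) t,
    fun _ => ⟨0, hk⟩, fun t => ?_, rfl⟩
  simp

lemma cost_le {n k m J : ℕ} (hn : 0 < n) (hk : 0 < k) (hJ : 0 < J) (x : Fin m → Fin n) :
    ((alg n J).cost x : ℝ) ≤ 2 * (n * (J + 2 ^ J) + m * J * (10 + 7 * Real.logb 2 k)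
      + 14 * Fk n k x) := by
  obtain ⟨f, mv, hf, hF⟩ := exists_fingers hn hk x
  have h1 : ((alg n J).cost x : ℝ)
      ≤ 2 * ∑ j ∈ Finset.range J, ∑ t : Fin m, (pageCount n (ext x) j t : ℝ) := by
    rw [Finset.sum_comm, Finset.mul_sum, GeomAlg.cost]
    push_cast
    refine Finset.sum_le_sum fun t _ => ?_
    rw [Finset.mul_sum]
    exact_mod_cast card_touched_le hJ x t
  have h2 := Finset.sum_le_sum fun j (_ : j ∈ Finset.range J) => level_sum (x := x) hk j hf
  rw [Finset.sum_add_distrib, Finset.sum_add_distrib, ← Finset.mul_sum, ← Finset.mul_sum,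
    Finset.sum_add_distrib, Finset.sum_const, Finset.sum_const, Finset.card_range,
    nsmul_eq_mul, nsmul_eq_mul, mul_one] at h2
  have h6 : (∑ j ∈ Finset.range J, 7 * ∑ t : Fin m,
      ((if 2 ^ j ≤ fingerDist n (f t (mv t)) (x t) then 2 ^ j else 0 : ℕ) : ℝ))
      = 7 * ∑ t : Fin m, ∑ j ∈ Finset.range J,
        ((if 2 ^ j ≤ fingerDist n (f t (mv t)) (x t) then 2 ^ j else 0 : ℕ) : ℝ) := by
    rw [← Finset.mul_sum, Finset.sum_comm]
  have h3 : (∑ t : Fin m, ∑ j ∈ Finset.range J,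
      ((if 2 ^ j ≤ fingerDist n (f t (mv t)) (x t) then 2 ^ j else 0 : ℕ) : ℝ))
      ≤ 2 * Fk n k x := by
    rw [hF]
    exact_mod_cast (Finset.sum_le_sum fun (t : Fin m) (_ : t ∈ Finset.univ) =>
      sum_two_pow_le J (fingerDist n (f t (mv t)) (x t))).trans_eq (Finset.mul_sum _ _ _).symm
  have h4 : ∑ j ∈ Finset.range J, (2 : ℝ) ^ j ≤ 2 ^ J := by
    rw [geom_sum_eq (by norm_num)]
    norm_num
  have h5 := mul_le_mul_of_nonneg_left h4 (Nat.cast_nonneg (α := ℝ) n)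
  linarith

end HierGreedy

/-- There is a universal constant `C` such that for every `n ≥ 4` and every
integer `k ≥ 2` there is a finitely supported probability distribution over deterministic online
geometric BST algorithms — a randomized online algorithm `A` — with the property that for every
access sequence `X ∈ [n]^m` with `m ≥ n · (log₂ n)²`, the expected cost satisfies
`E[cost_A(X)] ≤ C · (F^k(X) + m · log₂ k · log₂ log₂ n)`. -/
theorem stmt5 :
    ∃ C : ℝ, 0 < C ∧ ∀ (n k : ℕ), 4 ≤ n → 2 ≤ k →
      ∃ (N : ℕ) (p : Fin N → ℝ) (alg : Fin N → GeomAlg n),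
        (∀ i, 0 ≤ p i) ∧ (∑ i, p i) = 1 ∧ (∀ i, (alg i).Valid) ∧
        ∀ (m : ℕ) (x : Fin m → Fin n), (n : ℝ) * (Real.logb 2 n) ^ 2 ≤ m →
          (∑ i, p i * ((alg i).cost x : ℝ)) ≤
            C * ((Fk n k x : ℝ) + m * Real.logb 2 k * Real.logb 2 (Real.logb 2 n)) := by
  refine ⟨200, by norm_num, fun n k hn hk => ?_⟩
  set J := Nat.clog 2 (Nat.clog 2 n) with hJdef
  have hc2 : 2 ≤ Nat.clog 2 n := by
    have : Nat.clog 2 4 ≤ Nat.clog 2 n := Nat.clog_mono_right 2 hn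
    have h4 : Nat.clog 2 4 = 2 := by
      rw [show (4 : ℕ) = 2 ^ 2 by norm_num, Nat.clog_pow 2 2 one_lt_two]
    omega
  have hJ : 0 < J := Nat.clog_pos one_lt_two hc2
  have hnB : n ≤ HierGreedy.blk J :=
    (Nat.le_pow_clog one_lt_two n).trans
      (Nat.pow_le_pow_right two_pos (Nat.le_pow_clog one_lt_two _))
  refine ⟨1, fun _ => 1, fun _ => HierGreedy.alg n J, by simp, by simp,
    fun _ => HierGreedy.alg_valid hJ hnB, fun m x hm => ?_⟩
  have hcost := HierGreedy.cost_le (k := k) (by omega) (by omega) hJ x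
  set L := Real.logb 2 n with hL
  have hn' : (4 : ℝ) ≤ n := by exact_mod_cast hn
  have hk' : (2 : ℝ) ≤ k := by exact_mod_cast hk
  have hclog : ∀ c : ℕ, 2 ≤ c → (Nat.clog 2 c : ℝ) ≤ Real.logb 2 c + 1 := by
    intro c hc
    have h1 : (2 : ℕ) ^ (Nat.clog 2 c - 1) < c := Nat.pow_pred_clog_lt_self one_lt_two (by omega)
    have h2 : 0 < Nat.clog 2 c := Nat.clog_pos one_lt_two hc
    have h3 : ((Nat.clog 2 c - 1 : ℕ) : ℝ) ≤ Real.logb 2 c := by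
      rw [Real.le_logb_iff_rpow_le one_lt_two (by positivity), Real.rpow_natCast]
      exact_mod_cast h1.le
    rw [Nat.cast_sub h2] at h3
    push_cast at h3
    linarith
  have hL2 : 2 ≤ L := by
    rw [hL, Real.le_logb_iff_rpow_le one_lt_two (by positivity)]
    norm_num
    exact hn
  have hcl : (Nat.clog 2 n : ℝ) ≤ 2 * L := by
    have := hclog n (by omega)
    linarith
  have hLL : 1 ≤ Real.logb 2 L := by
    rw [Real.le_logb_iff_rpow_le one_lt_two (by positivity)]
    simpa using hL2
  have hK : 1 ≤ Real.logb 2 k := by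
    rw [Real.le_logb_iff_rpow_le one_lt_two (by positivity)]
    simpa using hk'
  have hJle : (J : ℝ) ≤ 3 * Real.logb 2 L := by
    have h1 := hclog _ hc2
    have h2 : Real.logb 2 (Nat.clog 2 n) ≤ Real.logb 2 (2 * L) :=
      Real.logb_le_logb_of_le one_lt_two (by positivity) hcl
    rw [Real.logb_mul two_ne_zero (by positivity)] at h2
    have h3 : Real.logb 2 2 = 1 := by norm_num
    linarith
  have hpow : (2 : ℝ) ^ J ≤ 4 * L := by
    have h1 : (2 : ℕ) ^ (J - 1) < Nat.clog 2 n := Nat.pow_pred_clog_lt_self one_lt_two hc2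
    have h2 : (2 : ℕ) ^ J = 2 * 2 ^ (J - 1) := by
      rw [← pow_succ', Nat.sub_add_cancel hJ]
    have h3 : ((2 ^ J : ℕ) : ℝ) ≤ 2 * Nat.clog 2 n := by
      exact_mod_cast (by omega : 2 ^ J ≤ 2 * Nat.clog 2 n)
    push_cast at h3
    linarith
  have hJpow : (J : ℝ) ≤ 2 ^ J := by exact_mod_cast Nat.lt_two_pow_self.le
  have hm0 : (0 : ℝ) ≤ m := by positivity
  have hF0 : (0 : ℝ) ≤ Fk n k x := by positivity
  have hinit : (n : ℝ) * (J + 2 ^ J) ≤ 4 * m := by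
    have h1 : (n : ℝ) * (J + 2 ^ J) ≤ n * (8 * L) :=
      mul_le_mul_of_nonneg_left (by linarith) (by positivity)
    have h2 : (n : ℝ) * (2 * L) ≤ n * L ^ 2 :=
      mul_le_mul_of_nonneg_left (by nlinarith) (by positivity)
    linarith
  have hKL : 1 ≤ Real.logb 2 k * Real.logb 2 L := by nlinarith
  have hmain : (m : ℝ) * J * (10 + 7 * Real.logb 2 k)
      ≤ 51 * (m * Real.logb 2 k * Real.logb 2 L) := by
    calc (m : ℝ) * J * (10 + 7 * Real.logb 2 k)
        ≤ m * (3 * Real.logb 2 L) * (17 * Real.logb 2 k) := by gcongr; linarith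
      _ = _ := by ring
  have hmm : (m : ℝ) ≤ m * Real.logb 2 k * Real.logb 2 L := by
    rw [mul_assoc]; exact le_mul_of_one_le_right hm0 hKL
  simp only [Finset.univ_unique, Finset.sum_const, Finset.card_singleton, one_smul, one_mul]
  linarith
end

section
/- There is a universal constant C such that for every n ≥ 4 and every integer k ≥ 2, and every access sequence X = (x_1,…,x_m) ∈ [n]^m with m ≥ n·(log₂ n)² that contains no strictly decreasing subsequence of length k (i.e., X avoids the pattern (k, k−1, …, 1)), there is a (finitely supported) probability distribution over (deterministic) online geometric BST algorithms — a randomized online algorithm A — whose expected cost satisfies E[cost_A(X)] ≤ C·(n·k + m·log₂ k·log₂ log₂ n). -/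
open scoped Classical

namespace FingerTree

/-- The rank of index `e` in the static balanced tree on `ℕ`: larger means closer to the root. -/
def weight (e : ℕ) : ℕ := padicValNat 2 (e + 1)

/-- `c` is an ancestor of `i` in the static balanced tree. -/
def Anc (c i : ℕ) : Prop := ∀ e ∈ Set.uIcc c i, weight e ≤ weight c

theorem Anc.trans {c e i : ℕ} (h₁ : Anc c e) (h₂ : Anc e i) : Anc c i := by
  intro y hy
  rcases Set.uIcc_subset_uIcc_union_uIcc (b := e) hy with h | h
  · exact h₁ y h
  · exact (h₂ y h).trans (h₁ e Set.right_mem_uIcc)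

theorem Anc.refl (i : ℕ) : Anc i i := by
  intro y hy
  simp only [Set.uIcc_self, Set.mem_singleton_iff] at hy
  rw [hy]

theorem exists_weight_lt {c d : ℕ} (hcd : c < d) (h : weight c = weight d) :
    ∃ e, c < e ∧ e < d ∧ weight c < weight e := by
  unfold weight at *
  obtain ⟨a, ha⟩ := pow_padicValNat_dvd (p := 2) (n := c + 1)
  obtain ⟨b, hb⟩ := pow_padicValNat_dvd (p := 2) (n := d + 1)
  rw [← h] at hb
  set v := padicValNat 2 (c + 1) with hv
  have hpos : 0 < 2 ^ v := by positivity
  have odd_of : ∀ {N q : ℕ}, N + 1 = 2 ^ v * q → padicValNat 2 (N + 1) = v → ¬ 2 ∣ q := by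
    rintro N q hN hval ⟨q', rfl⟩
    have : 2 ^ (v + 1) ∣ N + 1 := ⟨q', by rw [hN]; ring⟩
    have := (padicValNat_dvd_iff_le (p := 2) (Nat.succ_ne_zero N)).1 this
    simp only [Nat.succ_eq_add_one] at this
    omega
  have hao := odd_of ha hv.symm
  have hbo := odd_of hb h.symm
  have hab : a < b := by
    by_contra hle
    have := Nat.mul_le_mul_left (2 ^ v) (not_lt.1 hle)
    omega
  obtain ⟨q, hq⟩ : 2 ∣ a + 1 := by omega
  have h1 : 2 ^ v * (a + 1) = 2 ^ v * a + 2 ^ v := by ring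
  have h2 : 2 ^ v * (a + 2) ≤ 2 ^ v * b := Nat.mul_le_mul_left _ (by omega)
  have h3 : 2 ^ v * (a + 2) = 2 ^ v * a + 2 ^ v + 2 ^ v := by ring
  refine ⟨2 ^ v * (a + 1) - 1, by omega, by omega, ?_⟩
  have h4 : 2 ^ v * (a + 1) - 1 + 1 = 2 ^ v * (a + 1) := by omega
  rw [h4]
  have h5 : 2 ^ (v + 1) ∣ 2 ^ v * (a + 1) := ⟨q, by rw [hq]; ring⟩
  have := (padicValNat_dvd_iff_le (p := 2) (a := 2 ^ v * (a + 1)) (by positivity)).1 h5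
  omega

theorem card_anc_le (M i : ℕ) :
    ((Finset.range M).filter (fun c => Anc c i)).card ≤ 2 * (Nat.log 2 M + 1) := by
  have key : ∀ c d : ℕ, Anc c i → Anc d i → (c ≤ i ↔ d ≤ i) → weight c = weight d → c < d →
      False := by
    intro c d hc hd hside hw hcd
    obtain ⟨e, h1, h2, h3⟩ := exists_weight_lt hcd hw
    by_cases hci : c ≤ i
    · have hdi := hside.1 hci
      have := hc e (Set.mem_uIcc.2 (Or.inl ⟨h1.le, by omega⟩))
      omega
    · have := hd e (Set.mem_uIcc.2 (Or.inr ⟨by omega, h2.le⟩))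
      omega
  have hcard : ((Finset.univ : Finset Bool) ×ˢ Finset.range (Nat.log 2 M + 1)).card
      = 2 * (Nat.log 2 M + 1) := by simp
  rw [← hcard]
  refine Finset.card_le_card_of_injOn (fun c => (decide (c ≤ i), weight c)) ?_ ?_
  · intro c hc
    simp only [Finset.coe_filter, Finset.mem_range, Set.mem_ofPred_eq] at hc
    have h1 : weight c ≤ Nat.log 2 (c + 1) := padicValNat_le_nat_log _
    have h2 : Nat.log 2 (c + 1) ≤ Nat.log 2 M := Nat.log_mono_right (by omega)
    simp only [Finset.coe_product, Set.mem_prod, Finset.mem_coe, Finset.mem_univ, true_and,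
      Finset.mem_range]
    omega
  · intro c hc d hd hcd
    simp only [Finset.coe_filter, Finset.mem_range, Set.mem_ofPred_eq] at hc hd
    simp only [Prod.mk.injEq, decide_eq_decide] at hcd
    rcases lt_trichotomy c d with h | h | h
    · exact (key c d hc.2 hd.2 hcd.1 hcd.2 h).elim
    · exact h
    · exact (key d c hd.2 hc.2 hcd.1.symm hcd.2.symm h).elim

/-- The height of key `a` in the search tree whose top part is the balanced tree on the fingers
`G 0 ≤ G 1 ≤ …`. The keys strictly between two consecutive fingers form a path, which starts at
the left end if the left finger has odd index, and at the right end otherwise. -/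
noncomputable def height (n M : ℕ) (G : ℕ → ℕ) (a : ℕ) : ℕ :=
  if ∃ e, G e = a then n + 1 + ((Finset.range M).filter (fun e => G e = a)).sup weight
  else if ∃ i, G (2 * i + 1) ≤ a ∧ ¬ G (2 * i + 2) ≤ a then n - a
  else a

section height

variable {n M : ℕ} {G : ℕ → ℕ}

theorem le_height_finger {e : ℕ} (he : e < M) : n + 1 + weight e ≤ height n M G (G e) := by
  rw [height, if_pos ⟨e, rfl⟩]
  have : weight e ≤ ((Finset.range M).filter (fun e' => G e' = G e)).sup weight :=
    Finset.le_sup (f := weight) (by simp [he])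
  omega

theorem exists_height_eq {a : ℕ} (hM : ∀ e, M ≤ e → G e = n) (ha : a < n) (h : ∃ e, G e = a) :
    ∃ c < M, G c = a ∧ height n M G a = n + 1 + weight c := by
  have lt_of : ∀ e, G e = a → e < M := fun e he => by
    by_contra hlt
    have := hM e (not_lt.1 hlt)
    omega
  obtain ⟨e, he⟩ := h
  obtain ⟨c, hc, hsup⟩ := Finset.exists_mem_eq_sup ((Finset.range M).filter (fun e => G e = a))
    ⟨e, by simp [he, lt_of e he]⟩ weight
  simp only [Finset.mem_filter, Finset.mem_range] at hc
  exact ⟨c, hc.1, hc.2, by rw [height, if_pos ⟨e, he⟩, hsup]⟩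

theorem height_le {a : ℕ} (ha : a < n) (h : ¬ ∃ e, G e = a) : height n M G a ≤ n := by
  rw [height, if_neg h]
  split_ifs <;> omega

theorem height_congr {G' : ℕ → ℕ} {a : ℕ} (h₁ : ∀ e, G e = a ↔ G' e = a)
    (h₂ : ∀ e, G e ≤ a ↔ G' e ≤ a) : height n M G a = height n M G' a := by
  simp only [height, h₁, h₂]

/-- A set consisting of an interval of keys and of an ancestor-closed set of fingers is closed
under taking ancestors, provided that the interval is closed within its gaps. -/
theorem mem_of_isRoot (hG : Monotone G) (hM : ∀ e, M ≤ e → G e = n) {F : ℕ → Prop}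
    (hF : ∀ c e, F e → Anc c e → F c) {p q l r : ℕ} (hFp : F p) (hFq : F q)
    (hpl : G p ≤ l) (hlp : l ≤ G (p + 1)) (hrq : r ≤ G q) (hqr : ∀ c < q, G c ≤ r)
    (hgap : ∀ b z, l ≤ b → b ≤ r → b < n → z < n → (∀ e, G e ∉ Set.uIcc b z) →
      height n M G b ≤ height n M G z → l ≤ z ∧ z ≤ r)
    {b z : ℕ} (hb : b < n) (hz : z < n)
    (hS : (l ≤ b ∧ b ≤ r) ∨ ∃ c < M, G c = b ∧ F c)
    (hroot : ∀ y ∈ Set.uIcc b z, height n M G y ≤ height n M G z) :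
    (l ≤ z ∧ z ≤ r) ∨ ∃ c < M, G c = z ∧ F c := by
  by_cases hfin : ∃ e, G e = z
  · obtain ⟨c, hcM, hcz, hch⟩ := exists_height_eq hM hz hfin
    have hw : ∀ e, G e ∈ Set.uIcc b z → weight e ≤ weight c := by
      intro e he
      have hlt : G e < n := by
        rcases Set.mem_uIcc.1 he with h | h <;> omega
      have heM : e < M := by
        by_contra h
        have := hM e (not_lt.1 h)
        omega
      have h1 := le_height_finger (n := n) (G := G) heM
      have h2 := hroot _ he
      omega
    rcases hS with ⟨hlb, hbr⟩ | ⟨e, heM, heb, hFe⟩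
    · by_cases hzl : z < l
      · refine Or.inr ⟨c, hcM, hcz, hF c p hFp fun e he => hw e ?_⟩
        have hcp : c ≤ p := by
          by_contra h
          have := hG (show p + 1 ≤ c by omega)
          omega
        rw [Set.uIcc_of_le hcp] at he
        have h1 := hG he.1
        have h2 := hG he.2
        exact Set.mem_uIcc.2 (Or.inr ⟨by omega, by omega⟩)
      by_cases hzr : r < z
      · refine Or.inr ⟨c, hcM, hcz, hF c q hFq fun e he => hw e ?_⟩
        have hcp : q ≤ c := by
          by_contra h
          have := hqr c (not_le.1 h)
          omega
        rw [Set.uIcc_of_ge hcp] at he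
        have h1 := hG he.1
        have h2 := hG he.2
        exact Set.mem_uIcc.2 (Or.inl ⟨by omega, by omega⟩)
      exact Or.inl ⟨not_lt.1 hzl, not_lt.1 hzr⟩
    · refine Or.inr ⟨c, hcM, hcz, hF c e hFe fun y hy => hw y ?_⟩
      rw [← heb, ← hcz]
      rcases Set.mem_uIcc.1 hy with h | h
      · exact Set.mem_uIcc.2 (Or.inr ⟨hG h.1, hG h.2⟩)
      · exact Set.mem_uIcc.2 (Or.inl ⟨hG h.1, hG h.2⟩)
  · have hno : ∀ e, G e ∉ Set.uIcc b z := by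
      intro e he
      have h1 := hroot _ he
      have h2 := height_le (M := M) hz hfin
      have h3 : n + 1 ≤ height n M G (G e) := by
        rw [height, if_pos ⟨e, rfl⟩]
        omega
      omega
    rcases hS with ⟨hlb, hbr⟩ | ⟨e, heM, heb, hFe⟩
    · exact Or.inl (hgap b z hlb hbr hb hz hno (hroot b Set.left_mem_uIcc))
    · exact (hno e (heb ▸ Set.left_mem_uIcc)).elim

end height

/-- The fingers after finger `2 * i + 1` has moved up to `x`. If it passes finger `2 * i + 2`,
then that one moves up to finger `2 * i + 3`. -/
def shift (G : ℕ → ℕ) (i x e : ℕ) : ℕ :=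
  if e = 2 * i + 1 then x
  else if e = 2 * i + 2 ∧ G (2 * i + 2) < x then G (2 * i + 3) else G e

/-- The right end of the interval touched when finger `2 * i + 1` moves up to `x`. -/
def bound (G : ℕ → ℕ) (i x : ℕ) : ℕ :=
  if G (2 * i + 2) < x then G (2 * i + 3) else x

/-- The fingers touched when finger `2 * i + 1` moves. -/
def Near (i c : ℕ) : Prop := Anc c (2 * i) ∨ Anc c (2 * i + 2) ∨ Anc c (2 * i + 3)

/-- The keys touched when finger `2 * i + 1` moves up to `x`. -/
def Reach (M : ℕ) (G : ℕ → ℕ) (i x a : ℕ) : Prop :=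
  (G (2 * i + 1) ≤ a ∧ a ≤ bound G i x) ∨ ∃ c < M, G c = a ∧ Near i c

section shift

variable {n M : ℕ} {G : ℕ → ℕ} {i x : ℕ}

theorem Near.anc {c e : ℕ} (h : Near i e) (hc : Anc c e) : Near i c := by
  rcases h with h | h | h
  · exact Or.inl (hc.trans h)
  · exact Or.inr (Or.inl (hc.trans h))
  · exact Or.inr (Or.inr (hc.trans h))

theorem shift_self : shift G i x (2 * i + 1) = x := by simp [shift]

theorem shift_of_ne {e : ℕ} (h₁ : e ≠ 2 * i + 1) (h₂ : e ≠ 2 * i + 2) :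
    shift G i x e = G e := by simp [shift, h₁, h₂]

theorem shift_next_of_lt (h : G (2 * i + 2) < x) :
    shift G i x (2 * i + 2) = G (2 * i + 3) := by simp [shift, h]

theorem shift_next_of_le (h : x ≤ G (2 * i + 2)) :
    shift G i x (2 * i + 2) = G (2 * i + 2) := by simp [shift, h]

theorem le_bound (hx : x < G (2 * i + 3)) : x ≤ bound G i x := by
  unfold bound
  split_ifs <;> omega

theorem shift_cases (hG : Monotone G) (hi : G (2 * i + 1) ≤ x) (hx : x < G (2 * i + 3)) (e : ℕ) :
    shift G i x e = G e ∨ (G (2 * i + 1) ≤ G e ∧ G e ≤ shift G i x e ∧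
      shift G i x e ≤ bound G i x) := by
  by_cases h1 : e = 2 * i + 1
  · subst h1
    rw [shift_self]
    exact Or.inr ⟨le_rfl, hi, le_bound hx⟩
  by_cases h2 : e = 2 * i + 2
  · subst h2
    by_cases h : G (2 * i + 2) < x
    · rw [shift_next_of_lt h, bound, if_pos h]
      exact Or.inr ⟨hG (by omega), hG (by omega), le_rfl⟩
    · exact Or.inl (shift_next_of_le (not_lt.1 h))
  · exact Or.inl (shift_of_ne h1 h2)

theorem le_shift (hG : Monotone G) (hi : G (2 * i + 1) ≤ x) (hx : x < G (2 * i + 3)) (e : ℕ) :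
    G e ≤ shift G i x e := by
  rcases shift_cases hG hi hx e with h | h
  · exact h.ge
  · exact h.2.1

theorem monotone_shift (hG : Monotone G) (hi : G (2 * i + 1) ≤ x) (hx : x < G (2 * i + 3)) :
    Monotone (shift G i x) := by
  refine monotone_nat_of_le_succ fun e => ?_
  have h0 := hG (show 2 * i ≤ 2 * i + 1 by omega)
  have h1 := hG (show 2 * i + 2 ≤ 2 * i + 3 by omega)
  have h2 := hG (show e ≤ e + 1 by omega)
  unfold shift
  split_ifs <;> grind

theorem reach_shift_iff (hG : Monotone G) (hi : G (2 * i + 1) ≤ x) (hx : x < G (2 * i + 3))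
    {a : ℕ} : Reach M G i x a ↔
      ((G (2 * i + 1) ≤ a ∧ a ≤ bound G i x) ∨ ∃ c < M, shift G i x c = a ∧ Near i c) := by
  constructor
  · rintro (h | ⟨c, hc, hca, hN⟩)
    · exact Or.inl h
    · rcases shift_cases hG hi hx c with h | h
      · exact Or.inr ⟨c, hc, h.trans hca, hN⟩
      · exact Or.inl ⟨by omega, by omega⟩
  · rintro (h | ⟨c, hc, hca, hN⟩)
    · exact Or.inl h
    · rcases shift_cases hG hi hx c with h | h
      · exact Or.inr ⟨c, hc, h.symm.trans hca, hN⟩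
      · exact Or.inl ⟨by omega, by omega⟩

theorem height_shift (hG : Monotone G) (hi : G (2 * i + 1) ≤ x) (hx : x < G (2 * i + 3))
    {a : ℕ} (ha : ¬ Reach M G i x a) :
    height n M (shift G i x) a = height n M G a := by
  have hout : ¬ (G (2 * i + 1) ≤ a ∧ a ≤ bound G i x) := fun h => ha (Or.inl h)
  refine height_congr (fun e => ?_) (fun e => ?_) <;>
  · rcases shift_cases hG hi hx e with h | h
    · rw [h]
    · omega

theorem reach_of_isRoot (hG : Monotone G) (hM : ∀ e, M ≤ e → G e = n)
    (hi : G (2 * i + 1) ≤ x) (hx : x < G (2 * i + 3)) {b z : ℕ} (hb : b < n) (hz : z < n)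
    (hS : Reach M G i x b)
    (hroot : ∀ y ∈ Set.uIcc b z, height n M G y ≤ height n M G z) : Reach M G i x z := by
  have mono1 := hG (show 2 * i ≤ 2 * i + 1 by omega)
  have mono2 := hG (show 2 * i + 1 ≤ 2 * i + 2 by omega)
  by_cases hc : G (2 * i + 2) < x
  · have hr : bound G i x = G (2 * i + 3) := if_pos hc
    refine mem_of_isRoot hG hM (F := Near i) (fun c e => Near.anc)
      (p := 2 * i) (q := 2 * i + 3) (Or.inl (Anc.refl _)) (Or.inr (Or.inr (Anc.refl _)))
      mono1 le_rfl hr.le (fun c hcq => hr ▸ hG (by omega)) ?_ hb hz hS hroot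
    intro b z hlb hbr hb hz hno _
    have h1 := mt Set.mem_uIcc.2 (hno (2 * i + 1))
    have h2 := mt Set.mem_uIcc.2 (hno (2 * i + 3))
    omega
  · have hr : bound G i x = x := if_neg hc
    refine mem_of_isRoot hG hM (F := Near i) (fun c e => Near.anc)
      (p := 2 * i) (q := 2 * i + 2) (Or.inl (Anc.refl _)) (Or.inr (Or.inl (Anc.refl _)))
      mono1 le_rfl (by omega) (fun c hcq => ?_) ?_ hb hz hS hroot
    · have := hG (show c ≤ 2 * i + 1 by omega)
      omega
    intro b z hlb hbr hb hz hno hh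
    have h1 := mt Set.mem_uIcc.2 (hno (2 * i + 1))
    refine ⟨by omega, ?_⟩
    by_contra hzr
    have h2 := mt Set.mem_uIcc.2 (hno (2 * i + 2))
    have hnb : ¬ ∃ e, G e = b := fun ⟨e, he⟩ => hno e (he ▸ Set.left_mem_uIcc)
    have hnz : ¬ ∃ e, G e = z := fun ⟨e, he⟩ => hno e (he ▸ Set.right_mem_uIcc)
    rw [height, height, if_neg hnb, if_neg hnz, if_pos ⟨i, hlb, by omega⟩,
      if_pos ⟨i, by omega, by omega⟩] at hh
    omega

theorem reach_of_isRoot_shift (hG : Monotone G) (hM : ∀ e, M ≤ e → G e = n) (hiM : 2 * i + 2 < M)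
    (hi : G (2 * i + 1) ≤ x) (hx : x < G (2 * i + 3)) {b z : ℕ} (hb : b < n) (hz : z < n)
    (hS : Reach M G i x b)
    (hroot : ∀ y ∈ Set.uIcc b z,
      height n M (shift G i x) y ≤ height n M (shift G i x) z) : Reach M G i x z := by
  have mono1 := hG (show 2 * i ≤ 2 * i + 1 by omega)
  have hG' := monotone_shift hG hi hx
  have hM' : ∀ e, M ≤ e → shift G i x e = n := fun e he => by
    rw [shift_of_ne (by omega) (by omega), hM e he]
  have e0 : shift G i x (2 * i) = G (2 * i) := shift_of_ne (by omega) (by omega)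
  have e1 : shift G i x (2 * i + 1) = x := shift_self
  have e3 : shift G i x (2 * i + 3) = G (2 * i + 3) := shift_of_ne (by omega) (by omega)
  have hxr := le_bound hx
  have hleft : ∀ b z, G (2 * i + 1) ≤ b → b < n → z < n →
      (∀ e, shift G i x e ∉ Set.uIcc b z) →
      height n M (shift G i x) b ≤ height n M (shift G i x) z → G (2 * i + 1) ≤ z := by
    intro b z hlb hb hz hno hh
    by_contra hzl
    have h0 := mt Set.mem_uIcc.2 (hno (2 * i))
    have h1 := mt Set.mem_uIcc.2 (hno (2 * i + 1))
    rw [e0] at h0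
    rw [e1] at h1
    have hnb : ¬ ∃ e, shift G i x e = b := fun ⟨e, he⟩ => hno e (he ▸ Set.left_mem_uIcc)
    have hnz : ¬ ∃ e, shift G i x e = z := fun ⟨e, he⟩ => hno e (he ▸ Set.right_mem_uIcc)
    have hgap : ∀ y, G (2 * i) ≤ y → y < x → ¬ ∃ j, shift G i x (2 * j + 1) ≤ y ∧
        ¬ shift G i x (2 * j + 2) ≤ y := by
      rintro y hy hyx ⟨j, hj1, hj2⟩
      rcases lt_or_ge j i with h | h
      · have := hG' (show 2 * j + 2 ≤ 2 * i by omega)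
        omega
      · have := hG' (show 2 * i + 1 ≤ 2 * j + 1 by omega)
        omega
    rw [height, height, if_neg hnb, if_neg hnz, if_neg (hgap b (by omega) (by omega)),
      if_neg (hgap z (by omega) (by omega))] at hh
    omega
  rw [reach_shift_iff hG hi hx] at hS ⊢
  by_cases hc : G (2 * i + 2) < x
  · have hr : bound G i x = G (2 * i + 3) := if_pos hc
    refine mem_of_isRoot hG' hM' (F := Near i) (fun c e => Near.anc)
      (p := 2 * i) (q := 2 * i + 3) (Or.inl (Anc.refl _)) (Or.inr (Or.inr (Anc.refl _)))
      (by omega) (by omega) (by omega) (fun c hcq => ?_) ?_ hb hz hS hroot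
    · have := hG' hcq.le
      omega
    intro b z hlb hbr hb hz hno hh
    refine ⟨hleft b z hlb hb hz hno hh, ?_⟩
    have h2 := mt Set.mem_uIcc.2 (hno (2 * i + 3))
    omega
  · have hr : bound G i x = x := if_neg hc
    have e2 : shift G i x (2 * i + 2) = G (2 * i + 2) := shift_next_of_le (not_lt.1 hc)
    refine mem_of_isRoot hG' hM' (F := Near i) (fun c e => Near.anc)
      (p := 2 * i) (q := 2 * i + 2) (Or.inl (Anc.refl _)) (Or.inr (Or.inl (Anc.refl _)))
      (by omega) (by omega) (by omega) (fun c hcq => ?_) ?_ hb hz hS hroot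
    · have := hG' (show c ≤ 2 * i + 1 by omega)
      omega
    intro b z hlb hbr hb hz hno hh
    refine ⟨hleft b z hlb hb hz hno hh, ?_⟩
    have h1 := mt Set.mem_uIcc.2 (hno (2 * i + 1))
    omega

theorem bound_add_sum_le (hG : Monotone G) (hi : G (2 * i + 1) ≤ x) (hx : x < G (2 * i + 3))
    (hiM : 2 * i + 2 < M) :
    bound G i x + ∑ e ∈ Finset.range M, G e ≤
      G (2 * i + 1) + ∑ e ∈ Finset.range M, shift G i x e := by
  have h1 : 2 * i + 1 ∈ Finset.range M := Finset.mem_range.2 (by omega)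
  have h2 : 2 * i + 2 ∈ (Finset.range M).erase (2 * i + 1) :=
    Finset.mem_erase.2 ⟨by omega, Finset.mem_range.2 hiM⟩
  rw [← Finset.add_sum_erase _ _ h1, ← Finset.add_sum_erase _ _ h2,
    ← Finset.add_sum_erase _ _ h1, ← Finset.add_sum_erase _ _ h2]
  have h3 : ∑ e ∈ ((Finset.range M).erase (2 * i + 1)).erase (2 * i + 2), G e ≤
      ∑ e ∈ ((Finset.range M).erase (2 * i + 1)).erase (2 * i + 2), shift G i x e :=
    Finset.sum_le_sum fun e _ => le_shift hG hi hx e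
  have h4 := le_shift hG hi hx (2 * i + 2)
  rw [shift_self]
  by_cases hc : G (2 * i + 2) < x
  · rw [bound, if_pos hc]
    rw [shift_next_of_lt hc] at h4 ⊢
    omega
  · rw [bound, if_neg hc]
    omega

theorem card_near_le (M i : ℕ) :
    ((Finset.range M).filter (Near i)).card ≤ 6 * (Nat.log 2 M + 1) := by
  have hsub : (Finset.range M).filter (Near i) ⊆
      (Finset.range M).filter (fun c => Anc c (2 * i)) ∪
      ((Finset.range M).filter (fun c => Anc c (2 * i + 2)) ∪
        (Finset.range M).filter (fun c => Anc c (2 * i + 3))) := by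
    intro c hc
    simp only [Finset.mem_filter, Finset.mem_union, Near] at hc ⊢
    tauto
  have h0 := Finset.card_le_card hsub
  have h1 := Finset.card_union_le ((Finset.range M).filter (fun c => Anc c (2 * i)))
    ((Finset.range M).filter (fun c => Anc c (2 * i + 2)) ∪
        (Finset.range M).filter (fun c => Anc c (2 * i + 3)))
  have h2 := Finset.card_union_le ((Finset.range M).filter (fun c => Anc c (2 * i + 2)))
    ((Finset.range M).filter (fun c => Anc c (2 * i + 3)))
  have h3 := card_anc_le M (2 * i)
  have h4 := card_anc_le M (2 * i + 2)
  have h5 := card_anc_le M (2 * i + 3)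
  omega

theorem card_reach_le (hi : G (2 * i + 1) ≤ x) (hx : x < G (2 * i + 3)) :
    (Finset.univ.filter (fun a : Fin n => Reach M G i x a)).card + G (2 * i + 1) ≤
      bound G i x + 1 + 6 * (Nat.log 2 M + 1) := by
  have hsub : (Finset.univ.filter (fun a : Fin n => Reach M G i x a)).image Fin.val ⊆
      Finset.Icc (G (2 * i + 1)) (bound G i x) ∪ ((Finset.range M).filter (Near i)).image G := by
    intro a ha
    simp only [Finset.mem_image, Finset.mem_filter, Finset.mem_univ, true_and] at ha
    obtain ⟨a, (h | ⟨c, hc, hca, hN⟩), rfl⟩ := ha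
    · exact Finset.mem_union_left _ (Finset.mem_Icc.2 h)
    · exact Finset.mem_union_right _
        (Finset.mem_image.2 ⟨c, by simp [hc, hN], hca⟩)
  have h0 := Finset.card_le_card hsub
  rw [Finset.card_image_of_injective _ Fin.val_injective] at h0
  have h1 := Finset.card_union_le (Finset.Icc (G (2 * i + 1)) (bound G i x))
    (((Finset.range M).filter (Near i)).image G)
  rw [Nat.card_Icc] at h1
  have h2 : (((Finset.range M).filter (Near i)).image G).card ≤ _ := Finset.card_image_le
  have h3 := card_near_le M i
  have h4 := le_bound hx
  omega

end shift

/-- The index of the finger that moves when `x` is accessed. -/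
noncomputable def active (K : ℕ) (G : ℕ → ℕ) (x : ℕ) : ℕ :=
  Nat.findGreatest (fun i => G (2 * i + 1) ≤ x) (K - 1)

/-- The fingers after an access to `x`; they do not move if all movable fingers exceed `x`. -/
noncomputable def step (K : ℕ) (G : ℕ → ℕ) (x : ℕ) : ℕ → ℕ :=
  if G 1 ≤ x then shift G (active K G x) x else G

/-- The keys touched by an access to `x`; all keys if all movable fingers exceed `x`. -/
def Touch (K : ℕ) (G : ℕ → ℕ) (x a : ℕ) : Prop :=
  G 1 ≤ x → Reach (2 * K + 1) G (active K G x) x a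

/-- The fingers are sorted, and all but the first `2 * K + 1` of them are parked at `n`. -/
structure Sorted (n K : ℕ) (G : ℕ → ℕ) : Prop where
  mono : Monotone G
  top : ∀ e, 2 * K + 1 ≤ e → G e = n

section step

variable {n K : ℕ} {G : ℕ → ℕ} {x : ℕ}

theorem active_lt (hK : 0 < K) : active K G x < K := by
  have : active K G x ≤ K - 1 := Nat.findGreatest_le _
  omega

theorem finger_active_le (h : G 1 ≤ x) : G (2 * active K G x + 1) ≤ x :=
  Nat.findGreatest_spec (P := fun i => G (2 * i + 1) ≤ x) (m := 0) (Nat.zero_le _) h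

theorem Sorted.lt_finger_active (hG : Sorted n K G) (hx : x < n) :
    x < G (2 * active K G x + 3) := by
  by_cases h : active K G x + 1 ≤ K - 1
  · have := Nat.findGreatest_is_greatest (P := fun i => G (2 * i + 1) ≤ x)
      (Nat.lt_succ_self (active K G x)) h
    simpa [mul_add] using this
  · rw [hG.top _ (by omega)]
    exact hx

theorem Sorted.step (hG : Sorted n K G) (hK : 0 < K) (hx : x < n) :
    Sorted n K (step K G x) := by
  unfold FingerTree.step
  split_ifs with h
  · refine ⟨monotone_shift hG.mono (finger_active_le h) (hG.lt_finger_active hx), ?_⟩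
    intro e he
    have := active_lt (G := G) (x := x) hK
    rw [shift_of_ne (by omega) (by omega), hG.top e he]
  · exact hG

theorem Sorted.height_step (hG : Sorted n K G) (hx : x < n) {a : ℕ} (ha : ¬ Touch K G x a) :
    height n (2 * K + 1) (FingerTree.step K G x) a = height n (2 * K + 1) G a := by
  unfold Touch at ha
  push Not at ha
  rw [FingerTree.step, if_pos ha.1]
  exact height_shift hG.mono (finger_active_le ha.1) (hG.lt_finger_active hx) ha.2

theorem Sorted.touch_of_isRoot (hG : Sorted n K G) (hx : x < n) {b z : ℕ}
    (hb : b < n) (hz : z < n) (hS : Touch K G x b)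
    (hroot : ∀ y ∈ Set.uIcc b z, height n (2 * K + 1) G y ≤ height n (2 * K + 1) G z) :
    Touch K G x z := fun h =>
  reach_of_isRoot hG.mono hG.top (finger_active_le h) (hG.lt_finger_active hx) hb hz (hS h) hroot

theorem Sorted.touch_of_isRoot_step (hG : Sorted n K G) (hK : 0 < K) (hx : x < n) {b z : ℕ}
    (hb : b < n) (hz : z < n) (hS : Touch K G x b)
    (hroot : ∀ y ∈ Set.uIcc b z, height n (2 * K + 1) (FingerTree.step K G x) y ≤
      height n (2 * K + 1) (FingerTree.step K G x) z) :
    Touch K G x z := fun h => by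
  rw [FingerTree.step, if_pos h] at hroot
  have := active_lt (G := G) (x := x) hK
  exact reach_of_isRoot_shift hG.mono hG.top (by omega) (finger_active_le h)
    (hG.lt_finger_active hx) hb hz (hS h) hroot

theorem Sorted.touch_self (hG : Sorted n K G) (hx : x < n) : Touch K G x x := fun h =>
  Or.inl ⟨finger_active_le h, le_bound (hG.lt_finger_active hx)⟩

theorem Sorted.card_touch_add_sum_le (hG : Sorted n K G) (hK : 0 < K) (hx : x < n)
    (h : G 1 ≤ x) :
    (Finset.univ.filter (fun a : Fin n => Touch K G x a)).card +
        ∑ e ∈ Finset.range (2 * K + 1), G e ≤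
      1 + 6 * (Nat.log 2 (2 * K + 1) + 1) +
        ∑ e ∈ Finset.range (2 * K + 1), FingerTree.step K G x e := by
  have h0 := active_lt (G := G) (x := x) hK
  have h1 := card_reach_le (n := n) (M := 2 * K + 1) (finger_active_le (K := K) h)
    (hG.lt_finger_active hx)
  have h2 := bound_add_sum_le (M := 2 * K + 1) hG.mono (finger_active_le (K := K) h)
    (hG.lt_finger_active hx) (by omega)
  rw [FingerTree.step, if_pos h]
  simp only [Touch, h, true_imp_iff]
  omega

end step

/-- Touched sets that are closed under taking ancestors, both before and after a rearrangement of
the tree that affects touched keys only, satisfy the arboral condition. -/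
theorem exists_between (n m : ℕ) (S : ℕ → ℕ → Prop) (h : ℕ → ℕ → ℕ)
    (persist : ∀ t < m, ∀ a < n, ¬ S t a → h (t + 1) a = h t a)
    (before : ∀ t < m, ∀ b < n, ∀ z < n, S t b →
      (∀ y ∈ Set.uIcc b z, h t y ≤ h t z) → S t z)
    (after : ∀ t < m, ∀ b < n, ∀ z < n, S t b →
      (∀ y ∈ Set.uIcc b z, h (t + 1) y ≤ h (t + 1) z) → S t z)
    {s t a b : ℕ} (hst : s < t) (htm : t < m) (ha : a < n) (hb : b < n) (hab : a ≠ b)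
    (hSa : S s a) (hSb : S t b) :
    ∃ c < n, ∃ u < m, S u c ∧ c ∈ Set.uIcc a b ∧ s ≤ u ∧ u ≤ t ∧
      ¬ (c = a ∧ u = s) ∧ ¬ (c = b ∧ u = t) := by
  by_contra hno
  push Not at hno
  have lt_of : ∀ c ∈ Set.uIcc a b, c < n := by
    intro c hc
    rcases Set.mem_uIcc.1 hc with h | h <;> omega
  obtain ⟨c, hc, hmax⟩ := Finset.exists_max_image (Finset.uIcc a b) (h (s + 1))
    ⟨a, Finset.left_mem_uIcc⟩
  rw [← Finset.mem_coe, Finset.coe_uIcc] at hc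
  replace hmax : ∀ y ∈ Set.uIcc a b, h (s + 1) y ≤ h (s + 1) c := fun y hy =>
    hmax y (by rwa [← Finset.mem_coe, Finset.coe_uIcc])
  have hSc : S s c := after s (by omega) a ha c (lt_of c hc) hSa fun y hy =>
    hmax y (Set.uIcc_subset_uIcc_left hc hy)
  have hca : c = a := by
    by_contra hne
    have := (hno c (lt_of c hc) s (by omega) hSc hc le_rfl hst.le fun h => (hne h).elim).2
    omega
  subst hca
  have hconst : ∀ u, s + 1 ≤ u → u ≤ t → ∀ y ∈ Set.uIcc c b, h u y = h (s + 1) y := by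
    intro u hu
    induction u, hu using Nat.le_induction with
    | base => intros; rfl
    | succ u hu ih =>
      intro hut y hy
      rw [persist u (by omega) y (lt_of y hy), ih (by omega) y hy]
      intro hS
      have := hno y (lt_of y hy) u (by omega) hS hy (by omega) (by omega) (by omega)
      omega
  have hSt : S t c := before t htm b hb c ha hSb fun y hy => by
    rw [Set.uIcc_comm] at hy
    rw [hconst t hst le_rfl y hy, hconst t hst le_rfl c hc]
    exact hmax y hy
  exact hab (hno c ha t htm hSt hc hst.le le_rfl (by omega)).1

/-- The initial fingers. -/
def start (n K e : ℕ) : ℕ := if e < 2 * K + 1 then 0 else n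

theorem sorted_start (n K : ℕ) : Sorted n K (start n K) := by
  refine ⟨fun a b hab => ?_, fun e he => ?_⟩
  · unfold start
    split_ifs <;> omega
  · simp [start, not_lt.2 he]

/-- The fingers after the accesses in `p`. -/
noncomputable def run {n : ℕ} (K : ℕ) (p : List (Fin n)) : ℕ → ℕ :=
  p.foldl (fun G x => step K G x) (start n K)

/-- The online algorithm with `K` movable fingers. -/
noncomputable def fingerAlg (n K : ℕ) : GeomAlg n where
  add p := if h : p ≠ [] then
      Finset.univ.filter (fun a : Fin n => Touch K (run K p.dropLast) (p.getLast h) a)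
    else ∅

theorem sorted_run {n K : ℕ} (hK : 0 < K) (p : List (Fin n)) : Sorted n K (run K p) := by
  induction p using List.reverseRecOn with
  | nil => exact sorted_start n K
  | append_singleton p a ih =>
    have : run K (p ++ [a]) = step K (run K p) a := by simp [run, List.foldl_append]
    rw [this]
    exact ih.step hK a.2

section alg

variable {n m K : ℕ} (x : Fin m → Fin n)

theorem take_succ_ofFn {t : ℕ} (ht : t < m) :
    (List.ofFn x).take (t + 1) = (List.ofFn x).take t ++ [x ⟨t, ht⟩] := by
  rw [List.take_succ_eq_append_getElem (by simpa using ht)]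
  simp

theorem run_succ {t : ℕ} (ht : t < m) :
    run K ((List.ofFn x).take (t + 1)) =
      step K (run K ((List.ofFn x).take t)) (x ⟨t, ht⟩ : ℕ) := by
  rw [take_succ_ofFn x ht]
  simp [run, List.foldl_append]

theorem touched_fingerAlg (hK : 0 < K) (t : Fin m) :
    (fingerAlg n K).touched x t = Finset.univ.filter
      (fun a : Fin n => Touch K (run K ((List.ofFn x).take t)) (x t) a) := by
  have hself := (sorted_run hK ((List.ofFn x).take t)).touch_self (x t).2
  have hadd : (fingerAlg n K).add ((List.ofFn x).take ((t : ℕ) + 1)) = Finset.univ.filter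
      (fun a : Fin n => Touch K (run K ((List.ofFn x).take t)) (x t) a) := by
    simp [take_succ_ofFn x t.2, fingerAlg]
  rw [GeomAlg.touched, hadd]
  exact Finset.insert_eq_of_mem (by simpa using hself)

theorem valid_fingerAlg (hK : 0 < K) : (fingerAlg n K).Valid := by
  intro m x
  have mem_points : ∀ p : ℤ × ℤ, p ∈ (fingerAlg n K).points x ↔
      ∃ (t : Fin m) (a : Fin n), Touch K (run K ((List.ofFn x).take t)) (x t) a ∧
        (((a : ℕ) : ℤ), ((t : ℕ) : ℤ)) = p := by
    intro p
    simp [GeomAlg.points, touched_fingerAlg x hK]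
  set S : ℕ → ℕ → Prop := fun t a =>
    ∀ ht : t < m, Touch K (run K ((List.ofFn x).take t)) (x ⟨t, ht⟩) a with hSdef
  have key : ∀ {s t : Fin m} {a b : Fin n}, s < t → a ≠ b →
      Touch K (run K ((List.ofFn x).take s)) (x s) a →
      Touch K (run K ((List.ofFn x).take t)) (x t) b →
      ∃ r ∈ (fingerAlg n K).points x, r ≠ (((a : ℕ) : ℤ), ((s : ℕ) : ℤ)) ∧
        r ≠ (((b : ℕ) : ℤ), ((t : ℕ) : ℤ)) ∧
        min ((a : ℕ) : ℤ) ((b : ℕ) : ℤ) ≤ r.1 ∧ r.1 ≤ max ((a : ℕ) : ℤ) ((b : ℕ) : ℤ) ∧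
        ((s : ℕ) : ℤ) ≤ r.2 ∧ r.2 ≤ ((t : ℕ) : ℤ) := by
    intro s t a b hst hab hSa hSb
    obtain ⟨c, hc, u, hu, hSu, hcab, hsu, hut, hne1, hne2⟩ :=
      exists_between n m S (fun t => height n (2 * K + 1) (run K ((List.ofFn x).take t)))
        (by
          intro t ht a _ hS
          simp only [hSdef, ht, forall_true_left] at hS
          rw [run_succ x ht]
          exact (sorted_run hK _).height_step (x _).2 hS)
        (by
          intro t ht b hb z hz hS hroot ht'
          exact (sorted_run hK _).touch_of_isRoot (x _).2 hb hz (hS ht) hroot)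
        (by
          intro t ht b hb z hz hS hroot ht'
          simp only [run_succ x ht] at hroot
          exact (sorted_run hK _).touch_of_isRoot_step hK (x _).2 hb hz (hS ht) hroot)
        (show (s : ℕ) < t from hst) t.2 a.2 b.2 (fun h => hab (Fin.ext h))
        (fun _ => hSa) (fun _ => hSb)
    refine ⟨((c : ℤ), (u : ℤ)), (mem_points _).2 ⟨⟨u, hu⟩, ⟨c, hc⟩, hSu hu, rfl⟩, ?_, ?_, ?_⟩
    · simpa [Prod.ext_iff] using hne1
    · simpa [Prod.ext_iff] using hne2
    · rcases Set.mem_uIcc.1 hcab with h | h <;> refine ⟨?_, ?_, ?_, ?_⟩ <;> dsimp only <;> omega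
  intro p hp q hq h1 h2
  obtain ⟨s, a, hSa, rfl⟩ := (mem_points p).1 hp
  obtain ⟨t, b, hSb, rfl⟩ := (mem_points q).1 hq
  have hab : a ≠ b := by
    rintro rfl
    exact h1 rfl
  rcases lt_trichotomy s t with hlt | rfl | hlt
  · obtain ⟨r, hr, hne1, hne2, hr1, hr2, hr3, hr4⟩ := key hlt hab hSa hSb
    refine ⟨r, hr, hne1, hne2, hr1, hr2, ?_, ?_⟩
    · exact (min_le_left _ _).trans hr3
    · exact hr4.trans (le_max_right _ _)
  · exact (h2 rfl).elim
  · obtain ⟨r, hr, hne1, hne2, hr1, hr2, hr3, hr4⟩ := key hlt hab.symm hSb hSa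
    refine ⟨r, hr, hne2, hne1, ?_, ?_, ?_, ?_⟩
    · rwa [min_comm]
    · rwa [max_comm]
    · exact (min_le_right _ _).trans hr3
    · exact hr4.trans (le_max_left _ _)

/-- Some strictly decreasing subsequence of length `j + 1` ends at time `s`. -/
def Chain (x : Fin m → Fin n) : ℕ → Fin m → Prop
  | 0, _ => True
  | j + 1, s => ∃ s' < s, x s < x s' ∧ Chain x j s'

variable {x}

theorem Chain.exists_strictAnti {j : ℕ} {s : Fin m} (h : Chain x j s) :
    ∃ f : Fin (j + 1) → Fin m, StrictMono f ∧ StrictAnti (fun i => x (f i)) ∧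
      f (Fin.last j) = s := by
  induction j generalizing s with
  | zero =>
    exact ⟨fun _ => s, Subsingleton.strictMono (α := Fin 1) _,
      fun a b hab => absurd hab (by omega), rfl⟩
  | succ j ih =>
    obtain ⟨s', hs, hx, hc⟩ := h
    obtain ⟨f, hf, hxf, hlast⟩ := ih hc
    refine ⟨Fin.snoc (α := fun _ => Fin m) f s, ?_, ?_, by simp⟩
    · refine Fin.strictMono_iff_lt_succ.2 fun i => ?_
      induction i using Fin.lastCases with
      | last => simpa [hlast, ← Fin.castSucc_succ] using hs
      | cast i => simpa [← Fin.castSucc_succ] using hf (Fin.castSucc_lt_succ)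
    · refine Fin.strictAnti_iff_succ_lt.2 fun i => ?_
      induction i using Fin.lastCases with
      | last => simpa [hlast, ← Fin.castSucc_succ] using hx
      | cast i => simpa [← Fin.castSucc_succ] using hxf (Fin.castSucc_lt_succ)

theorem chain_of_finger (hK : 0 < K) {t : ℕ} (ht : t ≤ m) :
    ∀ i < K, 0 < run K ((List.ofFn x).take t) (2 * i + 1) →
      ∃ s : Fin m, (s : ℕ) < t ∧ (x s : ℕ) = run K ((List.ofFn x).take t) (2 * i + 1) ∧
        Chain x (K - 1 - i) s := by
  induction t with
  | zero =>
    intro i hi h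
    simp [run, start, show 2 * i + 1 < 2 * K + 1 by omega] at h
  | succ t ih =>
    intro i hi h
    have htm : t < m := by omega
    rw [run_succ x htm] at h ⊢
    have ih := ih htm.le
    have hG := sorted_run hK ((List.ofFn x).take t)
    set G := run K ((List.ofFn x).take t)
    unfold step at h ⊢
    by_cases hle : G 1 ≤ (x ⟨t, htm⟩ : ℕ)
    · rw [if_pos hle] at h ⊢
      by_cases hia : i = active K G (x ⟨t, htm⟩)
      · have hlt := hG.lt_finger_active (x ⟨t, htm⟩).2
        rw [← hia] at h hlt ⊢
        rw [shift_self] at h ⊢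
        refine ⟨⟨t, htm⟩, by simp, rfl, ?_⟩
        by_cases hlast : i + 1 < K
        · obtain ⟨s, hs, hxs, hc⟩ := ih (i + 1) hlast (by
            rw [show 2 * (i + 1) + 1 = 2 * i + 3 by ring]
            omega)
          rw [show 2 * (i + 1) + 1 = 2 * i + 3 by ring] at hxs
          rw [show K - 1 - i = K - 1 - (i + 1) + 1 by omega]
          exact ⟨s, hs, by rw [Fin.lt_def]; omega, hc⟩
        · rw [show K - 1 - i = 0 by omega]
          trivial
      · rw [shift_of_ne (by omega) (by omega)] at h ⊢
        obtain ⟨s, hs, h⟩ := ih i hi h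
        exact ⟨s, by omega, h⟩
    · rw [if_neg hle] at h ⊢
      obtain ⟨s, hs, h⟩ := ih i hi h
      exact ⟨s, by omega, h⟩

theorem lowest_finger_le (hK : 0 < K) (hx : ∀ s, ¬ Chain x K s) (t : Fin m) :
    run K ((List.ofFn x).take t) 1 ≤ x t := by
  by_contra h
  obtain ⟨s, hs, hxs, hc⟩ := chain_of_finger (x := x) hK t.2.le 0 hK (by simpa using by omega)
  refine hx t ?_
  rw [show K = K - 1 - 0 + 1 by omega]
  exact ⟨s, hs, by rw [Fin.lt_def]; simp at hxs; omega, hc⟩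

theorem cost_fingerAlg_le (hK : 0 < K) (hx : ∀ s, ¬ Chain x K s) :
    (fingerAlg n K).cost x ≤
      m * (1 + 6 * (Nat.log 2 (2 * K + 1) + 1)) + (2 * K + 1) * n := by
  set Φ : ℕ → ℕ := fun t => ∑ e ∈ Finset.range (2 * K + 1), run K ((List.ofFn x).take t) e with hΦ
  set B := 1 + 6 * (Nat.log 2 (2 * K + 1) + 1) with hB
  set c : ℕ → ℕ := fun t =>
    if ht : t < m then ((fingerAlg n K).touched x ⟨t, ht⟩).card else 0 with hc
  have hcost : (fingerAlg n K).cost x = ∑ t ∈ Finset.range m, c t := by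
    rw [GeomAlg.cost, ← Fin.sum_univ_eq_sum_range]
    simp [hc]
  have hstep : ∀ t < m, c t + Φ t ≤ B + Φ (t + 1) := by
    intro t ht
    simp only [hc, hΦ, ht, dif_pos, touched_fingerAlg x hK, run_succ x ht]
    exact (sorted_run hK _).card_touch_add_sum_le hK (x ⟨t, ht⟩).2
      (lowest_finger_le hK hx ⟨t, ht⟩)
  have hsum : ∀ t ≤ m, ∑ u ∈ Finset.range t, c u ≤ t * B + Φ t := by
    intro t
    induction t with
    | zero => simp
    | succ t ih =>
      intro ht
      have h1 := ih (by omega)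
      have h2 := hstep t ht
      rw [Finset.sum_range_succ, add_mul, one_mul]
      omega
  have hΦm : Φ m ≤ (2 * K + 1) * n := by
    have hG := sorted_run hK ((List.ofFn x).take m)
    calc Φ m ≤ ∑ _e ∈ Finset.range (2 * K + 1), n := Finset.sum_le_sum fun e he => by
          have h1 := hG.mono (show e ≤ 2 * K + 1 by simp at he; omega)
          rwa [hG.top _ le_rfl] at h1
      _ = _ := by simp
  rw [hcost]
  exact (hsum m le_rfl).trans (by omega)

end alg

end FingerTree

/-- There is a universal constant `C` such that for every `n ≥ 4`, every
integer `k ≥ 2`, and every access sequence `X ∈ [n]^m` with `m ≥ n · (log₂ n)²` avoiding the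
pattern `(k, k-1, …, 1)` (no strictly decreasing subsequence of length `k`), there is a finitely
supported probability distribution over deterministic online geometric BST algorithms — a
randomized online algorithm `A` — whose expected cost satisfies
`E[cost_A(X)] ≤ C · (n · k + m · log₂ k · log₂ log₂ n)`. -/
theorem stmt7 :
    ∃ C : ℝ, 0 < C ∧ ∀ (n k : ℕ), 4 ≤ n → 2 ≤ k →
      ∀ (m : ℕ) (x : Fin m → Fin n), (n : ℝ) * (Real.logb 2 n) ^ 2 ≤ m →
        (¬ ∃ f : Fin k → Fin m, StrictMono f ∧ StrictAnti (fun i => x (f i))) →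
        ∃ (N : ℕ) (p : Fin N → ℝ) (alg : Fin N → GeomAlg n),
          (∀ i, 0 ≤ p i) ∧ (∑ i, p i) = 1 ∧ (∀ i, (alg i).Valid) ∧
          (∑ i, p i * ((alg i).cost x : ℝ)) ≤
            C * ((n : ℝ) * k + m * Real.logb 2 k * Real.logb 2 (Real.logb 2 n)) := by
  refine ⟨20, by norm_num, ?_⟩
  intro n k hn hk m x _ hx
  obtain ⟨K, rfl⟩ : ∃ K, k = K + 1 := ⟨k - 1, by omega⟩
  have hK : 0 < K := by omega
  have hchain : ∀ s, ¬ FingerTree.Chain x K s := fun s hs =>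
    let ⟨f, hf, hxf, _⟩ := hs.exists_strictAnti
    hx ⟨f, hf, hxf⟩
  refine ⟨1, fun _ => 1, fun _ => FingerTree.fingerAlg n K, fun _ => zero_le_one, by simp,
    fun _ => FingerTree.valid_fingerAlg hK, ?_⟩
  have hcost := FingerTree.cost_fingerAlg_le hK hchain
  have hcost : ((FingerTree.fingerAlg n K).cost x : ℝ) ≤
      m * (1 + 6 * ((Nat.log 2 (2 * K + 1) : ℕ) + 1)) + (2 * K + 1) * n := by
    exact_mod_cast hcost
  have hlogn : 1 ≤ Real.logb 2 (Real.logb 2 n) := by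
    have h4 : (2 : ℝ) ≤ Real.logb 2 n := by
      rw [Real.le_logb_iff_rpow_le (by norm_num) (by positivity)]
      norm_num
      exact_mod_cast hn
    rw [Real.le_logb_iff_rpow_le (by norm_num) (by linarith)]
    simpa using h4
  have hlogk : 1 ≤ Real.logb 2 ((K + 1 : ℕ) : ℝ) := by
    rw [Real.le_logb_iff_rpow_le (by norm_num) (by positivity)]
    simpa using (by exact_mod_cast hk : (2 : ℝ) ≤ ((K + 1 : ℕ) : ℝ))
  have hlogK : ((Nat.log 2 (2 * K + 1) : ℕ) : ℝ) ≤ Real.logb 2 ((K + 1 : ℕ) : ℝ) + 1 := by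
    have h1 : ((Nat.log 2 (2 * K + 1) : ℕ) : ℝ) ≤ Real.logb 2 ((2 * K + 1 : ℕ) : ℝ) := by
      exact_mod_cast Real.natLog_le_logb (2 * K + 1) 2
    have h2 : Real.logb 2 ((2 * K + 1 : ℕ) : ℝ) ≤ Real.logb 2 (((K + 1 : ℕ) : ℝ) * 2) :=
      Real.logb_le_logb_of_le (by norm_num) (by positivity) (by push_cast; linarith)
    rw [Real.logb_mul (by positivity) (by norm_num), Real.logb_self_eq_one (by norm_num)] at h2
    linarith
  set L := Real.logb 2 ((K + 1 : ℕ) : ℝ)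
  have hm : (0 : ℝ) ≤ m := Nat.cast_nonneg m
  have h1 : (m : ℝ) * (1 + 6 * ((Nat.log 2 (2 * K + 1) : ℕ) + 1)) ≤ m * (20 * L) :=
    mul_le_mul_of_nonneg_left (by linarith) hm
  have h2 : (m : ℝ) * L ≤ m * L * Real.logb 2 (Real.logb 2 n) :=
    le_mul_of_one_le_right (by positivity) hlogn
  have h3 : (2 * K + 1 : ℝ) * n ≤ 20 * (n * ((K + 1 : ℕ) : ℝ)) := by
    push_cast
    nlinarith [mul_nonneg (Nat.cast_nonneg (α := ℝ) n) (Nat.cast_nonneg (α := ℝ) K),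
      Nat.cast_nonneg (α := ℝ) n]
  simp only [Finset.univ_unique, Finset.sum_singleton, one_mul]
  linarith
end
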